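/- O_{g,n}(V) is a two-sided ideal of V under the product *_{g,n}, i.e. V *_{g,n} O_{g,n}(V) ⊆ O_{g,n}(V) and O_{g,n}(V) *_{g,n} V ⊆ O_{g,n}(V). -/

import Mathlib

/-
Common framework for formalizing
"Twisted representations of vertex operator algebras and associative algebras"
by C. Dong, H. Li, G. Mason.

We formalize a vertex operator algebra `V` over `ℂ` through its modes
`u_m = mode u m` (`m : ℤ`), vacuum `𝟏`, conformal vector `ω` (so that
`L(n) = ω_{n+1}`), a weight grading `wtSpace`, and the Borcherds identity.
An automorphism `g` of finite order `T` gives eigenspaces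
`V^r = eigSpace V g T r`.  For `n = l + i/T` the subspace `O_{g,n}(V)` is
`Ogn V g T l i`, the product `*_{g,n}` is `starMul V g T l`
(it only depends on `l`), and `A_{g,n}(V) = V.carrier ⧸ Ogn V g T l i`.
-/

noncomputable section

open scoped BigOperators

namespace DLM

/-- Generalized binomial coefficient `binom(α, j)` for a rational `α`. -/
def qchoose (α : ℚ) (j : ℕ) : ℚ :=
  (∏ k ∈ Finset.range j, (α - (k : ℚ))) / (Nat.factorial j : ℚ)

/-- A vertex operator algebra over `ℂ`, given by its modes `u_m v = mode u m v`
(the coefficients of `Y(u,z)v`), the vacuum `𝟏`, the conformal vector `ω`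
(with `L(n) = ω_{n+1}`), and the integer weight grading. -/
structure VOA where
  carrier : Type
  [acg : AddCommGroup carrier]
  [mod : Module ℂ carrier]
  mode : carrier →ₗ[ℂ] (ℤ → carrier →ₗ[ℂ] carrier)
  vacuum : carrier
  conformal : carrier
  wtSpace : ℤ → Submodule ℂ carrier
  [decomp : DirectSum.Decomposition wtSpace]
  findim : ∀ k : ℤ, FiniteDimensional ℂ (wtSpace k)
  bounded_below : ∃ N : ℤ, ∀ k : ℤ, k < N → wtSpace k = ⊥
  trunc : ∀ u v : carrier, ∃ N : ℤ, ∀ m : ℤ, N ≤ m → mode u m v = 0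
  vacuum_wt : vacuum ∈ wtSpace 0
  conformal_wt : conformal ∈ wtSpace 2
  vacuum_mode : ∀ (m : ℤ) (v : carrier), mode vacuum m v = if m = -1 then v else 0
  creation₁ : ∀ u : carrier, mode u (-1) vacuum = u
  creation₂ : ∀ (u : carrier) (m : ℤ), 0 ≤ m → mode u m vacuum = 0
  L0_grading : ∀ (k : ℤ), ∀ v ∈ wtSpace k, mode conformal 1 v = (k : ℂ) • v
  mode_grading : ∀ (a b m : ℤ) (u v : carrier), u ∈ wtSpace a → v ∈ wtSpace b →
    mode u m v ∈ wtSpace (a + b - m - 1)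
  Lneg1_mode : ∀ (u : carrier) (m : ℤ),
    mode (mode conformal 0 u) m = (-(m : ℂ)) • (mode u (m - 1))
  borcherds : ∀ (u v w : carrier) (p q s : ℤ),
    ∑ᶠ j : ℕ, ((qchoose (p : ℚ) j : ℚ) : ℂ) • mode (mode u (s + j) v) (p + q - j) w =
    ∑ᶠ j : ℕ, ((-1 : ℂ) ^ j * ((qchoose (s : ℚ) j : ℚ) : ℂ)) •
      (mode u (p + s - j) (mode v (q + j) w)
        - ((-1 : ℂ) ^ s) • mode v (q + s - j) (mode u (p + j) w))

attribute [instance] VOA.acg VOA.mod VOA.decomp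

namespace VOA

/-- Projection of `u` onto its weight `k` homogeneous component. -/
def proj (V : VOA) (k : ℤ) (u : V.carrier) : V.carrier :=
  (((DirectSum.decompose V.wtSpace u) k : V.wtSpace k) : V.carrier)

/-- `res V α β u v = Res_z Y(u,z)v (1+z)^α z^{-β}
  = ∑_{j ≥ 0} binom(α, j) u_{j - β} v`. -/
def res (V : VOA) (α : ℚ) (β : ℤ) (u v : V.carrier) : V.carrier :=
  ∑ᶠ j : ℕ, ((qchoose α j : ℚ) : ℂ) • V.mode u ((j : ℤ) - β) v

end VOA

/-- An automorphism of a vertex operator algebra. -/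
structure VOAAut (V : VOA) where
  lin : V.carrier ≃ₗ[ℂ] V.carrier
  map_vacuum : lin V.vacuum = V.vacuum
  map_conformal : lin V.conformal = V.conformal
  map_mode : ∀ (u : V.carrier) (m : ℤ) (v : V.carrier),
    lin (V.mode u m v) = V.mode (lin u) m (lin v)
  map_wt : ∀ (k : ℤ) (u : V.carrier), u ∈ V.wtSpace k ↔ lin u ∈ V.wtSpace k

/-- The inverse automorphism `g⁻¹`. -/
def VOAAut.symm {V : VOA} (g : VOAAut V) : VOAAut V where
  lin := g.lin.symm
  map_vacuum := g.lin.injective (by rw [LinearEquiv.apply_symm_apply, g.map_vacuum])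
  map_conformal := g.lin.injective (by rw [LinearEquiv.apply_symm_apply, g.map_conformal])
  map_mode := fun u m v => g.lin.injective (by
    rw [LinearEquiv.apply_symm_apply, g.map_mode, LinearEquiv.apply_symm_apply,
      LinearEquiv.apply_symm_apply])
  map_wt := fun k u => by
    have h := (g.map_wt k (g.lin.symm u)).symm
    rwa [LinearEquiv.apply_symm_apply] at h

/-- The eigenspace `V^r = {v ∈ V | g v = e^{-2πir/T} v}`. -/
def eigSpace (V : VOA) (g : VOAAut V) (T r : ℕ) : Submodule ℂ V.carrier where
  carrier := {v | g.lin v =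
    Complex.exp (-(2 * (Real.pi : ℂ) * Complex.I * (r : ℂ)) / (T : ℂ)) • v}
  add_mem' := fun {a b} ha hb => by
    simp only [Set.mem_setOf_eq] at *
    rw [map_add, ha, hb, smul_add]
  zero_mem' := by simp
  smul_mem' := fun c a ha => by
    simp only [Set.mem_setOf_eq] at *
    rw [map_smul, ha, smul_comm]

/-- `δ_i(r)`: equals `1` if `r ≤ i` or `r = T`, and `0` otherwise. -/
def deltaI (T i r : ℕ) : ℕ := if r ≤ i ∨ r = T then 1 else 0

/-- `O_{g,n}(V)` for `n = l + i/T`: the span of all `L(-1)u + L(0)u` and all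
`u ∘_{g,n} v = Res_z Y(u,z)v (1+z)^{wt u - 1 + δ_i(r) + l + r/T}
 / z^{2l + δ_i(r) + δ_i(T-r)}` for homogeneous `u ∈ V^r`. -/
def Ogn (V : VOA) (g : VOAAut V) (T l i : ℕ) : Submodule ℂ V.carrier :=
  Submodule.span ℂ
    ({x | ∃ u : V.carrier, x = V.mode V.conformal 0 u + V.mode V.conformal 1 u} ∪
     {x | ∃ r : ℕ, r < T ∧ ∃ (k : ℤ) (u v : V.carrier),
        u ∈ V.wtSpace k ∧ u ∈ eigSpace V g T r ∧
        x = V.res ((k : ℚ) - 1 + (deltaI T i r : ℚ) + (l : ℚ) + (r : ℚ) / (T : ℚ))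
              (2 * (l : ℤ) + (deltaI T i r : ℤ) + (deltaI T i (T - r) : ℤ)) u v})

/-- The product `u *_{g,n} v` for `u` homogeneous of weight `k` in `V^0`:
`∑_{m=0}^{l} (-1)^m binom(m+l, l) Res_z Y(u,z) (1+z)^{wt u + l} z^{-(l+m+1)} v`. -/
def starFor (V : VOA) (l : ℕ) (k : ℤ) (u v : V.carrier) : V.carrier :=
  ∑ m ∈ Finset.range (l + 1),
    ((-1 : ℂ) ^ m * (Nat.choose (m + l) l : ℂ)) •
      V.res ((k : ℚ) + (l : ℚ)) ((l : ℤ) + (m : ℤ) + 1) u v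

/-- Projection onto the eigenspace `V^r` of the finite order automorphism `g`. -/
def eigProj (V : VOA) (g : VOAAut V) (T r : ℕ) (v : V.carrier) : V.carrier :=
  (T : ℂ)⁻¹ • ∑ t ∈ Finset.range T,
    Complex.exp ((2 * (Real.pi : ℂ) * Complex.I * (r : ℂ) * (t : ℂ)) / (T : ℂ)) •
      ((g.lin ^ t) v)

/-- The bilinear extension of `*_{g,n}` to all of `V` (it vanishes when the first
argument is homogeneous in `V^r`, `r ≠ 0`, and only depends on `l`). -/
def starMul (V : VOA) (g : VOAAut V) (T l : ℕ) (u v : V.carrier) : V.carrier :=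
  ∑ᶠ k : ℤ, starFor V l k (eigProj V g T 0 (V.proj k u)) v

/-- The subspace `O_{1,l}(V^0)` of the untwisted theory of the fixed point
subalgebra `V^0` (all `δ` terms equal `1`), viewed inside `V`. -/
def OgnV0 (V : VOA) (g : VOAAut V) (T l : ℕ) : Submodule ℂ V.carrier :=
  Submodule.span ℂ
    ({x | ∃ u ∈ eigSpace V g T 0, x = V.mode V.conformal 0 u + V.mode V.conformal 1 u} ∪
     {x | ∃ (k : ℤ) (u v : V.carrier),
        u ∈ V.wtSpace k ∧ u ∈ eigSpace V g T 0 ∧ v ∈ eigSpace V g T 0 ∧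
        x = V.res ((k : ℚ) + (l : ℚ)) (2 * (l : ℤ) + 2) u v})

/-- `e^{L(1)} v` (where `L(1) = ω_2`). -/
def expL1 (V : VOA) (v : V.carrier) : V.carrier :=
  ∑ᶠ j : ℕ, ((Nat.factorial j : ℂ))⁻¹ • ((fun w => V.mode V.conformal 2 w)^[j] v)

/-- The map `φ : v ↦ e^{L(1)} (-1)^{L(0)} v`. -/
def phiMap (V : VOA) (v : V.carrier) : V.carrier :=
  ∑ᶠ k : ℤ, ((-1 : ℂ) ^ k) • expL1 V (V.proj k v)

/-- `l`-component of `n - 1/T` when `n = l + i/T`. -/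
def predL (l i : ℕ) : ℕ := if i = 0 then l - 1 else l

/-- `i`-component of `n - 1/T` when `n = l + i/T`. -/
def predI (T i : ℕ) : ℕ := if i = 0 then T - 1 else i - 1

/-- The rational number `n = l + i/T`. -/
def nval (T l i : ℕ) : ℚ := (l : ℚ) + (i : ℚ) / (T : ℚ)

/-- A weak `g`-twisted `V`-module: modes `v_m = act v m` for `m ∈ (1/T)ℤ ⊆ ℚ`,
satisfying the truncation, vacuum and twisted Borcherds (Jacobi) identities. -/
structure TwModule (V : VOA) (g : VOAAut V) (T : ℕ) where
  carrier : Type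
  [acg : AddCommGroup carrier]
  [mod : Module ℂ carrier]
  act : V.carrier →ₗ[ℂ] (ℚ → carrier →ₗ[ℂ] carrier)
  act_eig : ∀ r : ℕ, r < T → ∀ u ∈ eigSpace V g T r, ∀ m : ℚ,
    (¬ ∃ z : ℤ, m = (z : ℚ) + (r : ℚ) / (T : ℚ)) → act u m = 0
  act_trunc : ∀ (u : V.carrier) (x : carrier), ∃ N : ℤ, ∀ m : ℚ, (N : ℚ) ≤ m → act u m x = 0
  act_vacuum : ∀ (m : ℚ) (x : carrier), act V.vacuum m x = if m = -1 then x else 0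
  jacobi : ∀ r s : ℕ, r < T → s < T → ∀ u ∈ eigSpace V g T r, ∀ v ∈ eigSpace V g T s,
    ∀ (a b c : ℤ) (x : carrier),
    ∑ᶠ j : ℕ, ((qchoose ((r : ℚ) / (T : ℚ) + (a : ℚ)) j : ℚ) : ℂ) •
        act (V.mode u (c + j) v) ((r : ℚ) / (T : ℚ) + (s : ℚ) / (T : ℚ) + a + b - j) x =
    ∑ᶠ j : ℕ, ((-1 : ℂ) ^ j * ((qchoose (c : ℚ) j : ℚ) : ℂ)) •
        (act u ((r : ℚ) / (T : ℚ) + a + c - j) (act v ((s : ℚ) / (T : ℚ) + b + j) x)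
          - ((-1 : ℂ) ^ c) •
            act v ((s : ℚ) / (T : ℚ) + b + c - j) (act u ((r : ℚ) / (T : ℚ) + a + j) x))

attribute [instance] TwModule.acg TwModule.mod

namespace TwModule

variable {V : VOA} {g : VOAAut V} {T : ℕ}

/-- The operator `o_p(a) = a_{wt a - 1 - p}`, extended linearly from homogeneous `a`. -/
def oactL (M : TwModule V g T) (p : ℚ) (a : V.carrier) : M.carrier →ₗ[ℂ] M.carrier :=
  ∑ᶠ k : ℤ, M.act (V.proj k a) ((k : ℚ) - 1 - p)

/-- `Ω_n(M) = {x ∈ M | V[g]_{-k} x = 0 for all k > n}`, i.e. `v_m x = 0` whenever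
`v` is homogeneous of weight `d` and `d - 1 - m < -n`. -/
def Omega (M : TwModule V g T) (n : ℚ) : Submodule ℂ M.carrier where
  carrier := {x | ∀ (k : ℤ) (u : V.carrier), u ∈ V.wtSpace k → ∀ m : ℚ,
    (k : ℚ) - 1 + n < m → M.act u m x = 0}
  add_mem' := fun {a b} ha hb => by
    intro k u hu m hm
    rw [map_add, ha k u hu m hm, hb k u hu m hm, add_zero]
  zero_mem' := fun k u hu m hm => map_zero _
  smul_mem' := fun c a ha => by
    intro k u hu m hm
    rw [map_smul, ha k u hu m hm, smul_zero]

theorem mem_Omega {M : TwModule V g T} {n : ℚ} {x : M.carrier} :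
    x ∈ M.Omega n ↔ ∀ (k : ℤ) (u : V.carrier), u ∈ V.wtSpace k → ∀ m : ℚ,
      (k : ℚ) - 1 + n < m → M.act u m x = 0 := Iff.rfl

/-- `Ω_{n-1/T}(M)`, viewed as a submodule of `Ω_n(M)`. -/
def OmegaSub (M : TwModule V g T) (n : ℚ) : Submodule ℂ (M.Omega n) :=
  (M.Omega (n - 1 / (T : ℚ))).comap (M.Omega n).subtype

/-- The quotient `Ω_n(M)/Ω_{n-1/T}(M)`. -/
abbrev OmegaQ (M : TwModule V g T) (n : ℚ) :=
  (M.Omega n) ⧸ (M.OmegaSub n)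

open Classical in
/-- The action of `o(a)` on `Ω_n(M)` (it does preserve `Ω_n(M)`). -/
def oactOmega (M : TwModule V g T) (n : ℚ) (a : V.carrier) :
    M.Omega n →ₗ[ℂ] M.Omega n :=
  if h : ∀ x ∈ M.Omega n, M.oactL 0 a x ∈ M.Omega n then (M.oactL 0 a).restrict h else 0

open Classical in
/-- The induced action of `o(a)` on `Ω_n(M)/Ω_{n-1/T}(M)`. -/
def oactQ (M : TwModule V g T) (n : ℚ) (a : V.carrier) :
    M.OmegaQ n →ₗ[ℂ] M.OmegaQ n :=
  if h : M.OmegaSub n ≤ (M.OmegaSub n).comap (M.oactOmega n a) then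
    Submodule.mapQ _ _ (M.oactOmega n a) h
  else 0

end TwModule

/-- A morphism of weak `g`-twisted `V`-modules. -/
structure TwHom {V : VOA} {g : VOAAut V} {T : ℕ} (M N : TwModule V g T) where
  toLin : M.carrier →ₗ[ℂ] N.carrier
  comm : ∀ (u : V.carrier) (m : ℚ) (x : M.carrier), toLin (M.act u m x) = N.act u m (toLin x)

namespace TwHom

variable {V : VOA} {g : VOAAut V} {T : ℕ}

def id (M : TwModule V g T) : TwHom M M := ⟨LinearMap.id, fun _ _ _ => rfl⟩

def comp {M N P : TwModule V g T} (f' : TwHom N P) (f : TwHom M N) : TwHom M P :=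
  ⟨f'.toLin.comp f.toLin, fun u m x => by
    simp only [LinearMap.comp_apply, f.comm, f'.comm]⟩

theorem mapsOmega {M N : TwModule V g T} (f : TwHom M N) (n : ℚ) :
    ∀ x ∈ M.Omega n, f.toLin x ∈ N.Omega n := fun x hx k u hu m hm => by
  rw [← f.comm, hx k u hu m hm, map_zero]

/-- The restriction of a morphism to `Ω_n`. -/
def omegaMap {M N : TwModule V g T} (f : TwHom M N) (n : ℚ) :
    M.Omega n →ₗ[ℂ] N.Omega n :=
  f.toLin.restrict (f.mapsOmega n)

/-- The induced map `Ω_n(M)/Ω_{n-1/T}(M) → Ω_n(N)/Ω_{n-1/T}(N)`. -/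
def omegaQMap {M N : TwModule V g T} (f : TwHom M N) (n : ℚ) :
    M.OmegaQ n →ₗ[ℂ] N.OmegaQ n :=
  Submodule.mapQ _ _ (f.omegaMap n) (fun x hx => f.mapsOmega (n - 1 / (T : ℚ)) x.1 hx)

end TwHom

/-- An admissible (`(1/T)ℤ≥0`-graded) `g`-twisted `V`-module. -/
structure AdmTwModule (V : VOA) (g : VOAAut V) (T : ℕ) extends TwModule V g T where
  grade : ℚ → Submodule ℂ carrier
  [gdecomp : DirectSum.Decomposition grade]
  grade_support : ∀ q : ℚ, (q < 0 ∨ ¬ ∃ z : ℤ, q = (z : ℚ) / (T : ℚ)) → grade q = ⊥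
  grade_act : ∀ (k : ℤ) (u : V.carrier), u ∈ V.wtSpace k → ∀ (m p : ℚ), ∀ x ∈ grade p,
    act u m x ∈ grade (p + (k : ℚ) - m - 1)

attribute [instance] AdmTwModule.gdecomp

namespace AdmTwModule

variable {V : VOA} {g : VOAAut V} {T : ℕ}

/-- A submodule invariant under all twisted vertex operators. -/
def InvSub (M : AdmTwModule V g T) (W : Submodule ℂ M.carrier) : Prop :=
  ∀ (u : V.carrier) (m : ℚ), ∀ x ∈ W, M.act u m x ∈ W

/-- A graded submodule (closed under homogeneous components). -/
def GradedSub (M : AdmTwModule V g T) (W : Submodule ℂ M.carrier) : Prop :=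
  ∀ x ∈ W, ∀ q : ℚ, (((DirectSum.decompose M.grade x) q : M.grade q) : M.carrier) ∈ W

/-- A simple (irreducible) admissible module: nonzero, with no proper nonzero
graded submodule. -/
def IsSimple (M : AdmTwModule V g T) : Prop :=
  (∃ x : M.carrier, x ≠ 0) ∧
  ∀ W : Submodule ℂ M.carrier, M.InvSub W → M.GradedSub W → W = ⊥ ∨ W = ⊤

/-- `W` is a simple (irreducible) admissible submodule of `M`. -/
def SubSimple (M : AdmTwModule V g T) (W : Submodule ℂ M.carrier) : Prop :=
  W ≠ ⊥ ∧ ∀ W' : Submodule ℂ M.carrier, W' ≤ W → M.InvSub W' → M.GradedSub W' →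
    W' = ⊥ ∨ W' = W

/-- `M` is a direct sum of irreducible admissible submodules. -/
def CompletelyReducible (M : AdmTwModule V g T) : Prop :=
  ∃ (κ : Type) (S : κ → Submodule ℂ M.carrier),
    (∀ j, M.InvSub (S j) ∧ M.GradedSub (S j) ∧ M.SubSimple (S j)) ∧
    iSupIndep S ∧ (⨆ j, S j) = ⊤

end AdmTwModule

/-- `V` is `g`-rational: every admissible `g`-twisted module is a direct sum of
irreducible admissible `g`-twisted modules. -/
def GRational (V : VOA) (g : VOAAut V) (T : ℕ) : Prop :=
  ∀ M : AdmTwModule V g T, M.CompletelyReducible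

/-- An ordinary `g`-twisted `V`-module: graded by `L(0)`-eigenvalues with
finite dimensional pieces and spectrum bounded below in each congruence class
mod `(1/T)ℤ`. -/
structure OrdTwModule (V : VOA) (g : VOAAut V) (T : ℕ) extends TwModule V g T where
  egrade : ℂ → Submodule ℂ carrier
  [edecomp : DirectSum.Decomposition egrade]
  egrade_L0 : ∀ lam : ℂ, ∀ x ∈ egrade lam, act V.conformal 1 x = lam • x
  egrade_findim : ∀ lam : ℂ, FiniteDimensional ℂ (egrade lam)
  egrade_bounded : ∀ lam : ℂ, ∃ N : ℤ, ∀ m : ℤ, m ≤ N →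
    egrade (lam + (m : ℂ) / (T : ℂ)) = ⊥

attribute [instance] OrdTwModule.edecomp

/-- A module over the associative algebra `A_{g,n}(V)` (with `n = l + i/T`),
given as a representation of `V` that kills `O_{g,n}(V)`, takes the vacuum to
the identity, and turns `*_{g,n}` into composition. -/
structure AMod (V : VOA) (g : VOAAut V) (T l i : ℕ) where
  carrier : Type
  [acg : AddCommGroup carrier]
  [mod : Module ℂ carrier]
  rho : V.carrier →ₗ[ℂ] (carrier →ₗ[ℂ] carrier)
  rho_O : ∀ a ∈ Ogn V g T l i, rho a = 0
  rho_one : rho V.vacuum = LinearMap.id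
  rho_star : ∀ a b : V.carrier, rho (starMul V g T l a b) = (rho a).comp (rho b)

attribute [instance] AMod.acg AMod.mod

namespace AMod

variable {V : VOA} {g : VOAAut V} {T l i : ℕ}

/-- `U` does not factor through `A_{g,n-1/T}(V)`. -/
def NotFactor (U : AMod V g T l i) : Prop :=
  ∃ a ∈ Ogn V g T (predL l i) (predI T i), U.rho a ≠ 0

/-- An invariant subspace. -/
def SubInv (U : AMod V g T l i) (W : Submodule ℂ U.carrier) : Prop :=
  ∀ a : V.carrier, ∀ x ∈ W, U.rho a x ∈ W

/-- `W` is a simple `A_{g,n}(V)`-submodule of `U`. -/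
def SubSimple (U : AMod V g T l i) (W : Submodule ℂ U.carrier) : Prop :=
  W ≠ ⊥ ∧ ∀ W' : Submodule ℂ U.carrier, W' ≤ W → U.SubInv W' → W' = ⊥ ∨ W' = W

/-- `U` is a simple `A_{g,n}(V)`-module. -/
def IsSimple (U : AMod V g T l i) : Prop :=
  (∃ x : U.carrier, x ≠ 0) ∧ ∀ W : Submodule ℂ U.carrier, U.SubInv W → W = ⊥ ∨ W = ⊤

/-- `U` is a direct sum of simple `A_{g,n}(V)`-modules. -/
def CompletelyReducible (U : AMod V g T l i) : Prop :=
  ∃ (κ : Type) (S : κ → Submodule ℂ U.carrier),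
    (∀ j, U.SubInv (S j) ∧ U.SubSimple (S j)) ∧ iSupIndep S ∧ (⨆ j, S j) = ⊤

/-- All irreducible components of `U` do not factor through `A_{g,n-1/T}(V)`. -/
def GoodComponents (U : AMod V g T l i) : Prop :=
  ∀ W : Submodule ℂ U.carrier, U.SubInv W → U.SubSimple W →
    ∃ a ∈ Ogn V g T (predL l i) (predI T i), ∃ x ∈ W, U.rho a x ≠ 0

end AMod

/-- A morphism of `A_{g,n}(V)`-modules. -/
structure AModHom {V : VOA} {g : VOAAut V} {T l i : ℕ} (U U' : AMod V g T l i) where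
  toLin : U.carrier →ₗ[ℂ] U'.carrier
  comm : ∀ (a : V.carrier) (x : U.carrier), toLin (U.rho a x) = U'.rho a (toLin x)

namespace AModHom

variable {V : VOA} {g : VOAAut V} {T l i : ℕ}

def id (U : AMod V g T l i) : AModHom U U := ⟨LinearMap.id, fun _ _ => rfl⟩

def comp {U U' U'' : AMod V g T l i} (f' : AModHom U' U'') (f : AModHom U U') :
    AModHom U U'' :=
  ⟨f'.toLin.comp f.toLin, fun a x => by simp only [LinearMap.comp_apply, f.comm, f'.comm]⟩

end AModHom

end DLM

namespace DLM

open HahnSeries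

section BinomialSeries

theorem choose_eq_prod (x : ℂ) (j : ℕ) :
    Ring.choose x j = (∏ k ∈ Finset.range j, (x - k)) / (j.factorial : ℂ) := by
  rw [Ring.choose_eq_smul, smul_eq_mul, ← Polynomial.aeval_eq_smeval, Polynomial.aeval_def,
    ← Polynomial.eval_map, descPochhammer_map, descPochhammer_eval_eq_prod_range, div_eq_inv_mul]

theorem qchoose_eq_choose (α : ℚ) (j : ℕ) : ((qchoose α j : ℚ) : ℂ) = Ring.choose (α : ℂ) j := by
  rw [choose_eq_prod, qchoose]
  push_cast
  rfl

theorem qchoose_intCast (n : ℤ) (j : ℕ) : ((qchoose (n : ℚ) j : ℚ) : ℂ) = Ring.choose (n : ℂ) j := by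
  rw [qchoose_eq_choose]; push_cast; rfl

theorem choose_succ_mul (x : ℂ) (j : ℕ) :
    ((j : ℂ) + 1) * Ring.choose x (j + 1) = (x - j) * Ring.choose x j := by
  rw [choose_eq_prod, choose_eq_prod, Finset.prod_range_succ, Nat.factorial_succ]
  have : (j : ℂ) + 1 ≠ 0 := by exact_mod_cast Nat.succ_ne_zero j
  have h2 : (j.factorial : ℂ) ≠ 0 := by exact_mod_cast Nat.factorial_ne_zero j
  push_cast
  field_simp

theorem choose_succ_mul' (x : ℂ) (j : ℕ) :
    ((j : ℂ) + 1) * Ring.choose x (j + 1) = x * Ring.choose (x - 1) j := by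
  have h := Ring.choose_succ_succ (x - 1) j
  rw [sub_add_cancel] at h
  rw [h]
  linear_combination choose_succ_mul (x - 1) j

theorem choose_ne_zero {x : ℂ} {j : ℕ} (h : ∀ k : ℕ, k < j → x ≠ k) : Ring.choose x j ≠ 0 := by
  rw [choose_eq_prod]
  refine div_ne_zero ?_ (by exact_mod_cast Nat.factorial_ne_zero j)
  exact Finset.prod_ne_zero_iff.2 fun k hk => sub_ne_zero.2 (h k (Finset.mem_range.1 hk))

theorem choose_mul_choose (x : ℂ) (i n : ℕ) :
    Ring.choose x i * Ring.choose (x - i) n = (n + i).choose i * Ring.choose x (n + i) := by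
  have h := Ring.choose_smul_choose x (Nat.le_add_left i n)
  rw [Nat.add_sub_cancel, nsmul_eq_mul] at h
  rw [h]

theorem vandermonde (x y : ℂ) (n : ℕ) :
    Ring.choose (x + y) n = ∑ i ∈ Finset.range (n + 1), Ring.choose x i * Ring.choose y (n - i) := by
  rw [Ring.add_choose_eq n (Commute.all x y), Finset.Nat.sum_antidiagonal_eq_sum_range_succ_mk]

theorem choose_neg_eq (x : ℂ) (n : ℕ) :
    Ring.choose (-x) n = (-1) ^ n * Ring.choose (x + n - 1) n := by
  rw [Ring.choose_neg]
  simp [Int.negOnePow, Units.smul_def]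

/-- The Laurent series `(1 + z) ^ x * z ^ n`. -/
def E (x : ℂ) (n : ℤ) : LaurentSeries ℂ :=
  ((PowerSeries.binomialSeries ℂ x : PowerSeries ℂ) : LaurentSeries ℂ) * single n 1

theorem E_coeff_add (x : ℂ) (n : ℤ) (j : ℕ) : (E x n).coeff (n + j) = Ring.choose x j := by
  rw [E, add_comm n, coeff_mul_single_add, LaurentSeries.coeff_coe_powerSeries]
  simp

theorem E_coeff_lt (x : ℂ) {n m : ℤ} (h : m < n) : (E x n).coeff m = 0 := by
  rw [E, ← sub_add_cancel m n, coeff_mul_single_add, PowerSeries.coeff_coe]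
  simp [h]

theorem E_mul (x y : ℂ) (n m : ℤ) : E x n * E y m = E (x + y) (n + m) := by
  simp only [E, PowerSeries.binomialSeries_add, PowerSeries.coe_mul]
  rw [mul_mul_mul_comm, single_mul_single, one_mul]

theorem E_zero (n : ℤ) : E 0 n = single n 1 := by
  simp [E]

theorem laurent_ext {f g : LaurentSeries ℂ} (n : ℤ) (hlt : ∀ m < n, f.coeff m = g.coeff m)
    (h : ∀ j : ℕ, f.coeff (n + j) = g.coeff (n + j)) : f = g := by
  ext m
  rcases lt_or_ge m n with hm | hm
  · exact hlt m hm
  · obtain ⟨j, rfl⟩ := Int.le.dest hm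
    exact h j

theorem E_succ (x : ℂ) (n : ℤ) : E (x + 1) n = E x n + E x (n + 1) := by
  refine laurent_ext n (fun m hm => ?_) fun j => ?_
  · rw [coeff_add, E_coeff_lt _ hm, E_coeff_lt _ hm, E_coeff_lt _ (by lia), add_zero]
  · rw [coeff_add, E_coeff_add, E_coeff_add]
    cases j with
    | zero => rw [E_coeff_lt _ (by simp)]; simp
    | succ j =>
      rw [show n + ((j + 1 : ℕ) : ℤ) = n + 1 + j by push_cast; ring, E_coeff_add,
        Ring.choose_succ_succ, add_comm]

theorem vandermonde_of_le (x y : ℂ) {n N : ℕ} (h : n ≤ N) :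
    ∑ i ∈ Finset.range (N + 1), (if i ≤ n then Ring.choose x i * Ring.choose y (n - i) else 0) =
      Ring.choose (x + y) n := by
  rw [vandermonde, ← Finset.sum_filter]
  refine Finset.sum_congr ?_ fun _ _ => rfl
  ext i
  simp only [Finset.mem_filter, Finset.mem_range]
  lia

theorem intCast_choose (n : ℤ) (k : ℕ) : ((Ring.choose n k : ℤ) : ℂ) = Ring.choose (n : ℂ) k :=
  Ring.map_choose (Int.castRingHom ℂ) n k

theorem hasseDeriv_coeff' (k : ℕ) (f : LaurentSeries ℂ) (n : ℤ) :
    (LaurentSeries.hasseDeriv ℂ k f).coeff n =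
      Ring.choose ((n + k : ℤ) : ℂ) k * f.coeff (n + k) := by
  rw [LaurentSeries.hasseDeriv_coeff, zsmul_eq_mul, intCast_choose]

theorem E_hasseDeriv (x : ℂ) (n : ℤ) (j : ℕ) :
    LaurentSeries.hasseDeriv ℂ j (E x n) = ∑ i ∈ Finset.range (j + 1),
      (Ring.choose x i * Ring.choose (n : ℂ) (j - i)) • E (x - i) (n - ((j - i : ℕ) : ℤ)) := by
  refine laurent_ext (n - j) (fun m hm => ?_) fun e => ?_
  · rw [hasseDeriv_coeff', E_coeff_lt _ (by lia), mul_zero, coeff_sum, Finset.sum_eq_zero]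
    intro i hi
    rw [coeff_smul, E_coeff_lt _ (by lia), smul_zero]
  · rw [hasseDeriv_coeff', show n - (j : ℤ) + e + j = n + e by ring, E_coeff_add, coeff_sum]
    have key : ∀ i ∈ Finset.range (j + 1),
        ((Ring.choose x i * Ring.choose (n : ℂ) (j - i)) •
          E (x - i) (n - ((j - i : ℕ) : ℤ))).coeff (n - j + e) =
        Ring.choose x e * (Ring.choose (e : ℂ) i * Ring.choose (n : ℂ) (j - i)) := by
      intro i hi
      have hi' : i ≤ j := Nat.lt_succ_iff.1 (Finset.mem_range.1 hi)
      rw [coeff_smul, smul_eq_mul]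
      rcases lt_or_ge e i with h | h
      · rw [E_coeff_lt _ (by push_cast [hi']; lia), Ring.choose_natCast, Nat.choose_eq_zero_of_lt h]
        simp
      · obtain ⟨d, rfl⟩ := Nat.exists_eq_add_of_le' h
        rw [show n - (j : ℤ) + ((d + i : ℕ) : ℤ) = n - ((j - i : ℕ) : ℤ) + d by
          push_cast [hi']; ring, E_coeff_add, Ring.choose_natCast]
        linear_combination Ring.choose (n : ℂ) (j - i) * choose_mul_choose x i d
    rw [Finset.sum_congr rfl key, ← Finset.mul_sum, ← vandermonde, mul_comm]
    push_cast
    rw [add_comm (n : ℂ)]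

theorem E_hasseDeriv_one (x : ℂ) (n : ℤ) :
    LaurentSeries.hasseDeriv ℂ 1 (E x n) = x • E (x - 1) n + (n : ℂ) • E x (n - 1) := by
  rw [E_hasseDeriv]
  simp [Finset.sum_range_succ, add_comm]

theorem E_hasseDeriv_zero (x : ℂ) (j : ℕ) :
    LaurentSeries.hasseDeriv ℂ j (E x 0) = Ring.choose x j • E (x - j) 0 := by
  rw [E_hasseDeriv, Finset.sum_eq_single_of_mem j (by simp)]
  · simp
  · intro i hi hij
    have : 0 < j - i := by rw [Finset.mem_range] at hi; lia
    rw [Int.cast_zero, Ring.choose_zero_pos ℂ this, mul_zero]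
    exact zero_smul ℂ (E (x - i) (0 - ((j - i : ℕ) : ℤ)))

end BinomialSeries

section Residue

variable (V : VOA)

theorem exists_coeff_eq_zero (f : LaurentSeries ℂ) : ∃ m : ℤ, ∀ n < m, f.coeff n = 0 :=
  ⟨f.order, fun _ h => coeff_eq_zero_of_lt_order h⟩

theorem rs_support_finite (f : LaurentSeries ℂ) (u v : V.carrier) :
    (Function.support fun n : ℤ => f.coeff n • V.mode u n v).Finite := by
  obtain ⟨a, ha⟩ := exists_coeff_eq_zero f
  obtain ⟨b, hb⟩ := V.trunc u v
  refine (Set.finite_Ico a b).subset fun n hn => ⟨?_, ?_⟩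
  · by_contra h
    exact hn (by simp [ha n (not_le.1 h)])
  · by_contra h
    exact hn (by simp [hb n (not_lt.1 h)])

/-- `Res_z f(z) Y(u, z) v`, trilinear in `f`, `u` and `v`. -/
def VOA.rs : LaurentSeries ℂ →ₗ[ℂ] V.carrier →ₗ[ℂ] V.carrier →ₗ[ℂ] V.carrier where
  toFun f := LinearMap.mk₂ ℂ (fun u v => ∑ᶠ n : ℤ, f.coeff n • V.mode u n v)
    (fun u u' v => by
      rw [← finsum_add_distrib (rs_support_finite V f u v) (rs_support_finite V f u' v)]
      simp)
    (fun c u v => by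
      rw [smul_finsum' c (rs_support_finite V f u v)]
      simp [smul_comm c])
    (fun u v v' => by
      rw [← finsum_add_distrib (rs_support_finite V f u v) (rs_support_finite V f u v')]
      simp)
    (fun c u v => by
      rw [smul_finsum' c (rs_support_finite V f u v)]
      simp [smul_comm c])
  map_add' f f' := by
    ext u v
    simp only [LinearMap.mk₂_apply, LinearMap.add_apply]
    rw [← finsum_add_distrib (rs_support_finite V f u v) (rs_support_finite V f' u v)]
    simp [add_smul]
  map_smul' c f := by
    ext u v
    simp only [LinearMap.mk₂_apply, LinearMap.smul_apply, RingHom.id_apply]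
    rw [smul_finsum' c (rs_support_finite V f u v)]
    simp [mul_smul]

theorem rs_apply (f : LaurentSeries ℂ) (u v : V.carrier) :
    V.rs f u v = ∑ᶠ n : ℤ, f.coeff n • V.mode u n v := rfl

theorem rs_single (p : ℤ) (u v : V.carrier) : V.rs (single p 1) u v = V.mode u p v := by
  rw [rs_apply, finsum_eq_single _ p fun n hn => by rw [coeff_single_of_ne hn, zero_smul]]
  simp

theorem rs_eq_zero {f : LaurentSeries ℂ} {u v : V.carrier}
    (h : ∀ n, f.coeff n = 0 ∨ V.mode u n v = 0) : V.rs f u v = 0 := by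
  rw [rs_apply]
  exact finsum_eq_zero_of_forall_eq_zero fun n => by rcases h n with h | h <;> simp [h]

theorem rs_E (x : ℂ) (n : ℤ) (u v : V.carrier) {J : ℕ} (h : ∀ j : ℕ, J ≤ j → V.mode u (n + j) v = 0) :
    V.rs (E x n) u v = ∑ j ∈ Finset.range J, Ring.choose x j • V.mode u (n + j) v := by
  rw [rs_apply, finsum_eq_sum_of_support_subset (s := (Finset.range J).image fun j : ℕ => n + (j : ℤ)),
    Finset.sum_image fun a _ b _ h => by simpa using h]
  · simp_rw [E_coeff_add]
  · intro m hm
    rcases lt_or_ge m n with hmn | hmn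
    · exact absurd (by simp [E_coeff_lt _ hmn]) hm
    · obtain ⟨j, rfl⟩ := Int.le.dest hmn
      have : j < J := by
        by_contra hj
        exact hm (by simp [h j (not_lt.1 hj)])
      simpa using this

theorem exists_mode_eq_zero (u v : V.carrier) (n : ℤ) :
    ∃ J : ℕ, ∀ j : ℕ, J ≤ j → V.mode u (n + j) v = 0 := by
  obtain ⟨N, hN⟩ := V.trunc u v
  exact ⟨(N - n).toNat, fun j hj => hN _ (by lia)⟩

theorem res_eq_rs (α : ℚ) (β : ℤ) (u v : V.carrier) : V.res α β u v = V.rs (E α (-β)) u v := by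
  obtain ⟨J, hJ⟩ := exists_mode_eq_zero V u v (-β)
  rw [rs_E V _ _ _ _ hJ, VOA.res, finsum_eq_sum_of_support_subset (s := Finset.range J)]
  · simp_rw [qchoose_eq_choose, sub_eq_neg_add]
  · intro j hj
    by_contra h
    exact hj (by simp [sub_eq_neg_add, hJ j (by simpa using h)])

end Residue

section Residue

variable (V : VOA)

/-- A linear map that only depends on finitely many polar and low order coefficients. -/
def IsCont {W : Type*} [AddCommGroup W] [Module ℂ W] (φ : LaurentSeries ℂ →ₗ[ℂ] W) : Prop :=
  ∃ M : ℤ, ∀ h : LaurentSeries ℂ, (∀ n < M, h.coeff n = 0) → φ h = 0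

theorem IsCont.sub {W : Type*} [AddCommGroup W] [Module ℂ W] {φ ψ : LaurentSeries ℂ →ₗ[ℂ] W}
    (hφ : IsCont φ) (hψ : IsCont ψ) : IsCont (φ - ψ) := by
  obtain ⟨M, hM⟩ := hφ
  obtain ⟨N, hN⟩ := hψ
  refine ⟨max M N, fun h hh => ?_⟩
  rw [LinearMap.sub_apply, hM h fun n hn => hh n (lt_max_of_lt_left hn),
    hN h fun n hn => hh n (lt_max_of_lt_right hn), sub_zero]

theorem IsCont.sum {W : Type*} [AddCommGroup W] [Module ℂ W] {ι : Type*} (s : Finset ι)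
    {φ : ι → LaurentSeries ℂ →ₗ[ℂ] W} (hφ : ∀ i, IsCont (φ i)) : IsCont (∑ i ∈ s, φ i) := by
  choose M hM using hφ
  rcases s.eq_empty_or_nonempty with rfl | hs
  · exact ⟨0, fun h _ => by simp⟩
  refine ⟨s.sup' hs M, fun h hh => ?_⟩
  rw [LinearMap.sum_apply]
  exact Finset.sum_eq_zero fun i hi => hM i h fun n hn => hh n (hn.trans_le (Finset.le_sup' M hi))

theorem IsCont.comp {W W' : Type*} [AddCommGroup W] [Module ℂ W] [AddCommGroup W'] [Module ℂ W']
    {φ : LaurentSeries ℂ →ₗ[ℂ] W} (hφ : IsCont φ) (ψ : W →ₗ[ℂ] W') : IsCont (ψ ∘ₗ φ) := by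
  obtain ⟨M, hM⟩ := hφ
  exact ⟨M, fun h hh => by rw [LinearMap.comp_apply, hM h hh, map_zero]⟩

theorem IsCont.eq_zero {W : Type*} [AddCommGroup W] [Module ℂ W] {φ : LaurentSeries ℂ →ₗ[ℂ] W}
    (hφ : IsCont φ) (hs : ∀ p : ℤ, φ (single p 1) = 0) : φ = 0 := by
  obtain ⟨M, hM⟩ := hφ
  ext f
  obtain ⟨m, hm⟩ := exists_coeff_eq_zero f
  have h : φ (f - ∑ n ∈ Finset.Ico m M, f.coeff n • single n (1 : ℂ)) = 0 := by
    refine hM _ fun n hn => ?_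
    rw [coeff_sub, coeff_sum]
    simp only [coeff_smul, coeff_single, smul_eq_mul, mul_ite, mul_one, mul_zero,
      Finset.sum_ite_eq, Finset.mem_Ico]
    split_ifs with hmn
    · simp
    · rw [hm n (by lia), sub_zero]
  rw [map_sub, map_sum] at h
  rw [LinearMap.zero_apply, sub_eq_zero.1 h]
  exact Finset.sum_eq_zero fun n _ => by rw [map_smul, hs, smul_zero]

theorem isCont_rs (u v : V.carrier) : IsCont ((V.rs.flip u).flip v) := by
  obtain ⟨N, hN⟩ := V.trunc u v
  refine ⟨N, fun h hh => rs_eq_zero V fun n => ?_⟩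
  rcases lt_or_ge n N with hn | hn
  · exact Or.inl (hh n hn)
  · exact Or.inr (hN n hn)

theorem mul_coeff_eq_zero {f g : LaurentSeries ℂ} {a b : ℤ} (hf : ∀ n < a, f.coeff n = 0)
    (hg : ∀ n < b, g.coeff n = 0) : ∀ n < a + b, (f * g).coeff n = 0 := by
  intro n hn
  rw [coeff_mul]
  refine Finset.sum_eq_zero fun ij hij => ?_
  rw [Finset.mem_antidiagonal] at hij
  rcases lt_or_ge ij.1 a with h | h
  · rw [hf _ h, zero_mul]
  · rw [hg _ (by lia), mul_zero]

/-- Multiplication of Laurent series as a bilinear map over the constants. -/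
def mulL : LaurentSeries ℂ →ₗ[ℂ] LaurentSeries ℂ →ₗ[ℂ] LaurentSeries ℂ :=
  LinearMap.mk₂ ℂ (fun f g => f * g) (fun _ _ _ => add_mul _ _ _)
    (fun c f g => by rw [← C_mul_eq_smul, ← C_mul_eq_smul, mul_assoc])
    (fun _ _ _ => mul_add _ _ _)
    (fun c f g => by rw [← C_mul_eq_smul, ← C_mul_eq_smul, mul_left_comm])

theorem mulL_apply (f g : LaurentSeries ℂ) : mulL f g = f * g := rfl

theorem isCont_rs_mul_right (f : LaurentSeries ℂ) (u v : V.carrier) :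
    IsCont (((V.rs.flip u).flip v) ∘ₗ mulL f) := by
  obtain ⟨M, hM⟩ := isCont_rs V u v
  obtain ⟨a, ha⟩ := exists_coeff_eq_zero f
  refine ⟨M - a, fun h hh => hM _ ?_⟩
  have := mul_coeff_eq_zero ha hh
  simpa [mulL_apply] using this

theorem isCont_rs_hasseDeriv_mul (g : LaurentSeries ℂ) (j : ℕ) (u v : V.carrier) :
    IsCont (((V.rs.flip u).flip v) ∘ₗ mulL.flip g ∘ₗ LaurentSeries.hasseDeriv ℂ j) := by
  obtain ⟨M, hM⟩ := isCont_rs V u v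
  obtain ⟨a, ha⟩ := exists_coeff_eq_zero g
  refine ⟨M - a + j, fun h hh => hM _ ?_⟩
  have hd : ∀ n < M - a, (LaurentSeries.hasseDeriv ℂ j h).coeff n = 0 := fun n hn => by
    rw [hasseDeriv_coeff', hh _ (by lia), mul_zero]
  have := mul_coeff_eq_zero hd ha
  simpa [mulL_apply] using this

theorem choose_zero_finsum {W : Type*} [AddCommGroup W] [Module ℂ W] (s : ℕ → ℂ) (F : ℕ → W)
    (h0 : s 0 = 1) :
    ∑ᶠ j : ℕ, (s j * ((qchoose ((0 : ℤ) : ℚ) j : ℚ) : ℂ)) • F j = F 0 := by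
  rw [finsum_eq_single _ 0]
  · rw [qchoose_intCast]; simp [h0]
  · intro j hj
    rw [qchoose_intCast, Int.cast_zero, Ring.choose_zero_pos ℂ (Nat.pos_of_ne_zero hj), mul_zero,
      zero_smul]

theorem mode_comm (a b w : V.carrier) {J : ℕ} (hJ : ∀ j : ℕ, J ≤ j → V.mode a j b = 0) (p q : ℤ) :
    V.mode a p (V.mode b q w) - V.mode b q (V.mode a p w) =
      ∑ j ∈ Finset.range J, Ring.choose (p : ℂ) j • V.mode (V.mode a j b) (p + q - j) w := by
  have h := V.borcherds a b w p q 0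
  rw [choose_zero_finsum _ _ (by simp), finsum_eq_sum_of_support_subset (s := Finset.range J)] at h
  · simpa [qchoose_intCast] using h.symm
  · intro j hj
    by_contra hjJ
    exact hj (by simp [hJ j (by simpa using hjJ)])

theorem rs_comm (a b : V.carrier) {J : ℕ} (hJ : ∀ j : ℕ, J ≤ j → V.mode a j b = 0)
    (f g : LaurentSeries ℂ) (w : V.carrier) :
    V.rs f a (V.rs g b w) - V.rs g b (V.rs f a w) =
      ∑ j ∈ Finset.range J, V.rs (LaurentSeries.hasseDeriv ℂ j f * g) (V.mode a j b) w := by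
  have h1 : ∀ p q : ℤ, V.rs (single p 1) a (V.rs (single q 1) b w) -
      V.rs (single q 1) b (V.rs (single p 1) a w) =
      ∑ j ∈ Finset.range J, V.rs (LaurentSeries.hasseDeriv ℂ j (single p 1) * single q 1)
        (V.mode a j b) w := by
    intro p q
    simp only [rs_single]
    rw [mode_comm V a b w hJ]
    refine Finset.sum_congr rfl fun j _ => ?_
    have : LaurentSeries.hasseDeriv ℂ j (single p (1 : ℂ)) * single q 1 =
        Ring.choose (p : ℂ) j • single (p + q - j) (1 : ℂ) := by
      rw [LaurentSeries.hasseDeriv_single, single_mul_single, zsmul_eq_mul, intCast_choose]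
      ext n
      rw [coeff_smul]
      simp [coeff_single, show p - (j : ℤ) + q = p + q - j by ring]
    rw [this, map_smul, LinearMap.smul_apply, LinearMap.smul_apply, rs_single]
  have h2 : ∀ (p : ℤ) (g : LaurentSeries ℂ), V.rs (single p 1) a (V.rs g b w) -
      V.rs g b (V.rs (single p 1) a w) =
      ∑ j ∈ Finset.range J, V.rs (LaurentSeries.hasseDeriv ℂ j (single p 1) * g)
        (V.mode a j b) w := by
    intro p g
    have hc := ((((isCont_rs V b w).comp (V.rs (single p 1) a)).sub
      (isCont_rs V b (V.rs (single p 1) a w))).sub (IsCont.sum (Finset.range J) fun j =>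
        isCont_rs_mul_right V (LaurentSeries.hasseDeriv ℂ j (single p 1)) (V.mode a j b) w)).eq_zero
        fun q => by
          simpa [LinearMap.sub_apply, LinearMap.sum_apply, mulL_apply] using sub_eq_zero.2 (h1 p q)
    have := LinearMap.congr_fun hc g
    exact sub_eq_zero.1 (by simpa [LinearMap.sub_apply, LinearMap.sum_apply, mulL_apply] using this)
  have hc := (((isCont_rs V a (V.rs g b w)).sub
    ((isCont_rs V a w).comp (V.rs g b))).sub (IsCont.sum (Finset.range J) fun j =>
      isCont_rs_hasseDeriv_mul V g j (V.mode a j b) w)).eq_zero fun p => by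
        simpa [LinearMap.sub_apply, LinearMap.sum_apply, mulL_apply] using sub_eq_zero.2 (h2 p g)
  have := LinearMap.congr_fun hc f
  exact sub_eq_zero.1 (by simpa [LinearMap.sub_apply, LinearMap.sum_apply, mulL_apply] using this)

theorem rs_L (f : LaurentSeries ℂ) (u v : V.carrier) :
    V.rs f (V.mode V.conformal 0 u) v = -V.rs (LaurentSeries.hasseDeriv ℂ 1 f) u v := by
  rw [eq_neg_iff_add_eq_zero]
  have hc : IsCont ((V.rs.flip (V.mode V.conformal 0 u)).flip v -
      -(((V.rs.flip u).flip v) ∘ₗ mulL.flip 1 ∘ₗ LaurentSeries.hasseDeriv ℂ 1)) :=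
    (isCont_rs V _ v).sub (by
      obtain ⟨M, hM⟩ := isCont_rs_hasseDeriv_mul V 1 1 u v
      exact ⟨M, fun h hh => by rw [LinearMap.neg_apply, hM h hh, neg_zero]⟩)
  have := LinearMap.congr_fun (hc.eq_zero fun p => ?_) f
  · simpa [mulL_apply] using this
  · have hd : LaurentSeries.hasseDeriv ℂ 1 (single p (1 : ℂ)) = (p : ℂ) • single (p - 1) (1 : ℂ) := by
      rw [LaurentSeries.hasseDeriv_single]
      ext n
      rw [coeff_smul]
      simp [coeff_single]
    simp only [sub_neg_eq_add, LinearMap.add_apply, LinearMap.comp_apply,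
      LinearMap.flip_apply, mulL_apply, mul_one]
    rw [hd, map_smul, LinearMap.smul_apply, LinearMap.smul_apply, rs_single, rs_single,
      V.Lneg1_mode, LinearMap.smul_apply, neg_smul, neg_add_cancel]

/-- The associator formula. -/
theorem mode_iterate (u v w : V.carrier) (s q : ℤ) {J : ℕ}
    (hu : ∀ j : ℕ, J ≤ j → V.mode u j w = 0) (hv : ∀ j : ℕ, J ≤ j → V.mode v (q + j) w = 0) :
    V.mode (V.mode u s v) q w = ∑ j ∈ Finset.range J, ((-1 : ℂ) ^ j * Ring.choose (s : ℂ) j) •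
      (V.mode u (s - j) (V.mode v (q + j) w) -
        ((-1 : ℂ) ^ s) • V.mode v (q + s - j) (V.mode u j w)) := by
  have h := V.borcherds u v w 0 q s
  have h0 := choose_zero_finsum (fun _ => 1)
    (fun j : ℕ => V.mode (V.mode u (s + j) v) (0 + q - j) w) rfl
  simp only [one_mul] at h0
  rw [h0, finsum_eq_sum_of_support_subset (s := Finset.range J)] at h
  · simpa [qchoose_intCast] using h
  · intro j hj
    by_contra hjJ
    have := hu j (by simpa using hjJ)
    have := hv j (by simpa using hjJ)
    exact hj (by simp_all)

end Residue

section Functional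

variable {V : VOA}

/-- The functional `f ↦ φ (Res_z f(z) Y(u, z) v)` on Laurent series. -/
def pr (φ : V.carrier →ₗ[ℂ] ℂ) (u v : V.carrier) : LaurentSeries ℂ →ₗ[ℂ] ℂ :=
  φ ∘ₗ (V.rs.flip u).flip v

theorem pr_apply (φ : V.carrier →ₗ[ℂ] ℂ) (u v : V.carrier) (f : LaurentSeries ℂ) :
    pr φ u v f = φ (V.rs f u v) := rfl

theorem pr_E (φ : V.carrier →ₗ[ℂ] ℂ) (x : ℂ) (n : ℤ) (u v : V.carrier) {J : ℕ}
    (h : ∀ j : ℕ, J ≤ j → V.mode u (n + j) v = 0) :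
    pr φ u v (E x n) = ∑ j ∈ Finset.range J, Ring.choose x j * φ (V.mode u (n + j) v) := by
  rw [pr_apply, rs_E V x n u v h, map_sum]
  simp_rw [map_smul, smul_eq_mul]

theorem pr_succ (φ : V.carrier →ₗ[ℂ] ℂ) (u v : V.carrier) (x : ℂ) (n : ℤ) :
    pr φ u v (E (x + 1) n) = pr φ u v (E x n) + pr φ u v (E x (n + 1)) := by
  rw [E_succ, map_add]

theorem pr_E_zero (φ : V.carrier →ₗ[ℂ] ℂ) (u v : V.carrier) (n : ℤ) :
    pr φ u v (E 0 n) = φ (V.mode u n v) := by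
  rw [E_zero, pr_apply, rs_single]

theorem pr_L (φ : V.carrier →ₗ[ℂ] ℂ) (u v : V.carrier) (x : ℂ) (n : ℤ) :
    pr φ (V.mode V.conformal 0 u) v (E x n) =
      -(x * pr φ u v (E (x - 1) n) + n * pr φ u v (E x (n - 1))) := by
  rw [pr_apply, rs_L, map_neg, ← pr_apply, E_hasseDeriv_one, map_add, map_smul, map_smul,
    smul_eq_mul, smul_eq_mul]

theorem L_mem_wtSpace {k : ℤ} {u : V.carrier} (hu : u ∈ V.wtSpace k) :
    V.mode V.conformal 0 u ∈ V.wtSpace (k + 1) := by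
  have := V.mode_grading 2 k 0 _ u V.conformal_wt hu
  rwa [show 2 + k - 0 - 1 = k + 1 by ring] at this

theorem rs_mem {W : Submodule ℂ V.carrier} {u v : V.carrier} (f : LaurentSeries ℂ)
    (h : ∀ n, V.mode u n v ∈ W) : V.rs f u v ∈ W := by
  rw [rs_apply]
  exact finsum_induction (· ∈ W) W.zero_mem (fun _ _ => W.add_mem) fun n => W.smul_mem _ (h n)

end Functional

section EigenSpace

variable {V : VOA} {g : VOAAut V} {T : ℕ}

theorem mem_eigSpace {r : ℕ} {v : V.carrier} : v ∈ eigSpace V g T r ↔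
    g.lin v = Complex.exp (-(2 * (Real.pi : ℂ) * Complex.I * (r : ℂ)) / (T : ℂ)) • v := Iff.rfl

theorem mode_mem_eigSpace {r s : ℕ} {u v : V.carrier} (hu : u ∈ eigSpace V g T r)
    (hv : v ∈ eigSpace V g T s) (n : ℤ) : V.mode u n v ∈ eigSpace V g T (r + s) := by
  rw [mem_eigSpace] at *
  rw [g.map_mode, hu, hv, map_smul, map_smul, Pi.smul_apply, LinearMap.smul_apply, smul_smul,
    ← Complex.exp_add]
  congr 2
  push_cast
  ring

theorem eigSpace_add_T (hT : 0 < T) (r : ℕ) : eigSpace V g T (r + T) = eigSpace V g T r := by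
  ext v
  rw [mem_eigSpace, mem_eigSpace]
  have hT' : (T : ℂ) ≠ 0 := by exact_mod_cast hT.ne'
  have : Complex.exp (-(2 * (Real.pi : ℂ) * Complex.I * ((r + T : ℕ) : ℂ)) / (T : ℂ)) =
      Complex.exp (-(2 * (Real.pi : ℂ) * Complex.I * (r : ℂ)) / (T : ℂ)) := by
    refine Eq.trans ?_ (Complex.exp_periodic.sub_eq _)
    congr 1
    push_cast
    field_simp
    ring
  rw [this]

theorem eigSpace_mod (hT : 0 < T) (r : ℕ) : eigSpace V g T (r % T) = eigSpace V g T r := by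
  conv_rhs => rw [← Nat.mod_add_div r T]
  induction r / T with
  | zero => simp
  | succ d ih => rw [Nat.mul_succ, ← add_assoc, eigSpace_add_T hT, ih]

theorem conformal_mem_eigSpace : V.conformal ∈ eigSpace V g T 0 := by
  rw [mem_eigSpace, g.map_conformal]; simp

theorem mode_mem_eigSpace_left {r : ℕ} {u v : V.carrier} (hu : u ∈ eigSpace V g T 0)
    (hv : v ∈ eigSpace V g T r) (n : ℤ) : V.mode u n v ∈ eigSpace V g T r := by
  simpa using mode_mem_eigSpace hu hv n

end EigenSpace

section Killing

variable {V : VOA} {g : VOAAut V} {T l i : ℕ} {φ : V.carrier →ₗ[ℂ] ℂ}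

/-- The functional `φ` vanishes on `O_{g,n}(V)`. -/
def Kills (V : VOA) (g : VOAAut V) (T l i : ℕ) (φ : V.carrier →ₗ[ℂ] ℂ) : Prop :=
  ∀ x ∈ Ogn V g T l i, φ x = 0

theorem mem_Ogn_of_kills {x : V.carrier} (h : ∀ φ, Kills V g T l i φ → φ x = 0) :
    x ∈ Ogn V g T l i := by
  by_contra hx
  obtain ⟨φ, hφx, hφ⟩ := Submodule.exists_le_ker_of_notMem hx
  exact hφx (h φ fun y hy => hφ hy)

/-- The shift of the exponent of `1 + z` in `u ∘ v`, for `u` in the `r`-th sector. -/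
def cexp (T l i r : ℕ) : ℂ := (deltaI T i r : ℂ) + l + r / T

/-- The pole order in `u ∘ v`, for `u` in the `r`-th sector. -/
def pexp (T l i r : ℕ) : ℕ := 2 * l + deltaI T i r + deltaI T i (T - r)

theorem cexp_zero : cexp T l i 0 = 1 + l := by simp [cexp, deltaI]

theorem pexp_zero : pexp T l i 0 = 2 * l + 2 := by simp [pexp, deltaI]

theorem Kills.L_add (hφ : Kills V g T l i φ) (u : V.carrier) :
    φ (V.mode V.conformal 0 u) + φ (V.mode V.conformal 1 u) = 0 := by
  rw [← map_add]
  exact hφ _ (Submodule.subset_span (Or.inl ⟨u, rfl⟩))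

theorem Kills.L (hφ : Kills V g T l i φ) {k : ℤ} {u : V.carrier} (hu : u ∈ V.wtSpace k) :
    φ (V.mode V.conformal 0 u) = -k * φ u := by
  have := hφ.L_add u
  rw [V.L0_grading k u hu, map_smul, smul_eq_mul] at this
  linear_combination this

theorem Ogn_gen_eq (r : ℕ) (k : ℤ) (u v : V.carrier) :
    V.res ((k : ℚ) - 1 + (deltaI T i r : ℚ) + (l : ℚ) + (r : ℚ) / (T : ℚ))
      (2 * (l : ℤ) + (deltaI T i r : ℤ) + (deltaI T i (T - r) : ℤ)) u v =
    V.rs (E (k - 1 + cexp T l i r) (-(pexp T l i r : ℤ))) u v := by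
  rw [res_eq_rs, cexp, pexp]
  push_cast
  congr 3
  ring_nf

theorem Kills.gen (hφ : Kills V g T l i φ) {r : ℕ} (hr : r < T) {k : ℤ} {u : V.carrier}
    (hu : u ∈ V.wtSpace k) (hur : u ∈ eigSpace V g T r) (v : V.carrier) :
    pr φ u v (E (k - 1 + cexp T l i r) (-(pexp T l i r : ℤ))) = 0 := by
  rw [pr_apply, ← Ogn_gen_eq]
  exact hφ _ (Submodule.subset_span (Or.inr ⟨r, hr, k, u, v, hu, hur, rfl⟩))

theorem Kills.gen_pole (hφ : Kills V g T l i φ) {r : ℕ} (hr : r < T) (hp : 0 < pexp T l i r)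
    (v : V.carrier) (m : ℕ) : ∀ {k : ℤ} {u : V.carrier} (_ : u ∈ V.wtSpace k)
    (_ : u ∈ eigSpace V g T r),
    pr φ u v (E (k - 1 + cexp T l i r) (-(pexp T l i r + m : ℤ))) = 0 := by
  induction m with
  | zero => intro k u hu hur; simpa using hφ.gen hr hu hur v
  | succ m ih =>
    intro k u hu hur
    have h := ih (L_mem_wtSpace hu) (mode_mem_eigSpace_left conformal_mem_eigSpace hur 0)
    have h0 := ih hu hur
    rw [pr_L] at h
    have e := pr_succ φ u v (k - 1 + cexp T l i r) (-(pexp T l i r + m : ℤ) - 1)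
    rw [sub_add_cancel] at e
    have e1 : ((k + 1 : ℤ) : ℂ) - 1 + cexp T l i r = k - 1 + cexp T l i r + 1 := by push_cast; ring
    rw [e1, e, add_sub_cancel_right, h0] at h
    have hne : ((-(pexp T l i r + m : ℤ) : ℤ) : ℂ) ≠ 0 := by
      exact_mod_cast (by lia : -(pexp T l i r + m : ℤ) ≠ 0)
    have h3 : ((-(pexp T l i r + m : ℤ) : ℤ) : ℂ) *
        pr φ u v (E (k - 1 + cexp T l i r) (-(pexp T l i r + m : ℤ) - 1)) = 0 := by
      linear_combination -h
    have := (mul_eq_zero.1 h3).resolve_left hne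
    convert this using 4
    push_cast
    ring

theorem Kills.gen_shift (hφ : Kills V g T l i φ) {r : ℕ} (hr : r < T) (hp : 0 < pexp T l i r)
    {k : ℤ} {u : V.carrier} (hu : u ∈ V.wtSpace k) (hur : u ∈ eigSpace V g T r) (v : V.carrier)
    (s : ℕ) : ∀ m : ℕ, s ≤ m →
    pr φ u v (E (k - 1 + cexp T l i r + s) (-(pexp T l i r + m : ℤ))) = 0 := by
  induction s with
  | zero => intro m _; simpa using hφ.gen_pole hr hp v m hu hur
  | succ s ih =>
    intro m hm
    obtain ⟨m, rfl⟩ : ∃ m', m = m' + 1 := ⟨m - 1, by lia⟩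
    have h1 := ih (m + 1) (by lia)
    have h2 := ih m (by lia)
    push_cast at h1 ⊢
    rw [← add_assoc, pr_succ, h1, zero_add]
    convert h2 using 3
    ring

theorem Kills.mode_vacuum (hφ : Kills V g T l i φ) (j : ℕ) : ∀ {k : ℤ} {x : V.carrier}
    (_ : x ∈ V.wtSpace k), φ (V.mode x (-1 - j) V.vacuum) = Ring.choose (-k : ℂ) j * φ x := by
  induction j with
  | zero => intro k x _; simp [V.creation₁]
  | succ j ih =>
    intro k x hx
    have h := ih (L_mem_wtSpace hx)
    rw [V.Lneg1_mode, LinearMap.smul_apply, map_smul, hφ.L hx, smul_eq_mul] at h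
    have hne : ((j : ℂ) + 1) ≠ 0 := by exact_mod_cast Nat.succ_ne_zero j
    have hc := choose_succ_mul' (-k : ℂ) j
    rw [show (-1 : ℤ) - ((j + 1 : ℕ) : ℤ) = -1 - j - 1 by push_cast; ring]
    refine mul_left_cancel₀ hne ?_
    rw [show (-((k + 1 : ℤ) : ℂ)) = -k - 1 by push_cast; ring] at h
    push_cast at h
    linear_combination h - φ x * hc

theorem neg_one_zpow_sq (n : ℤ) : ((-1 : ℂ) ^ n) * (-1 : ℂ) ^ n = 1 := by
  rw [← zpow_add₀ (by norm_num)]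
  exact Even.neg_one_zpow ⟨n, rfl⟩

theorem choose_neg_one (j : ℕ) : Ring.choose (-1 : ℂ) j = (-1) ^ j := by
  rw [choose_neg_eq, add_sub_cancel_left, Ring.choose_natCast]
  simp

theorem finsum_smul_eq_sum_range {W : Type*} [AddCommGroup W] [Module ℂ W] {J : ℕ} (c : ℕ → ℂ)
    (F : ℕ → W) (h : ∀ j, J ≤ j → F j = 0) :
    ∑ᶠ j : ℕ, c j • F j = ∑ j ∈ Finset.range J, c j • F j := by
  refine finsum_eq_sum_of_support_subset _ fun j hj => ?_
  by_contra hjJ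
  exact hj (by simp [h j (by simpa using hjJ)])

/-- Skew symmetry modulo `O_{g,n}(V)` for a single mode. -/
theorem Kills.skew_mode (hφ : Kills V g T l i φ) {k k' : ℤ} {u v : V.carrier}
    (hu : u ∈ V.wtSpace k) (hv : v ∈ V.wtSpace k') (s : ℤ) :
    φ (V.mode v s u) = -(-1) ^ s * pr φ u v (E (k + k' - 2 - s) s) := by
  have h := V.borcherds u v V.vacuum (-1) 0 s
  obtain ⟨J, hJ⟩ := exists_mode_eq_zero V u v s
  rw [finsum_smul_eq_sum_range (J := J) _ _ fun j hj => by rw [hJ j hj]; simp,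
    finsum_smul_eq_sum_range (J := 1) _ _ fun j hj => by
      rw [V.creation₂ v _ (by lia), V.creation₂ u _ (by lia)]; simp] at h
  have h' := congrArg φ h
  simp only [Finset.sum_range_one, qchoose_intCast, map_sum, map_smul, map_sub, smul_eq_mul] at h'
  have hv0 : V.mode v (0 + (0 : ℕ)) V.vacuum = 0 := V.creation₂ _ _ (by simp)
  have hu0 : V.mode u (-1 + (0 : ℕ)) V.vacuum = u := by simpa using V.creation₁ u
  rw [hv0, hu0] at h'
  simp only [map_zero, Ring.choose_zero_right, pow_zero, one_mul, zero_sub, zero_add, Nat.cast_zero,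
    sub_zero] at h'
  rw [pr_E φ _ s u v hJ]
  have key : ∀ j ∈ Finset.range J, Ring.choose ((-1 : ℤ) : ℂ) j *
      φ (V.mode (V.mode u (s + j) v) (-1 + 0 - j) V.vacuum) =
      Ring.choose ((k : ℂ) + k' - 2 - s) j * φ (V.mode u (s + j) v) := by
    intro j _
    rw [add_zero, hφ.mode_vacuum j (V.mode_grading k k' _ u v hu hv)]
    push_cast
    rw [choose_neg_one, choose_neg_eq, ← mul_assoc, ← mul_assoc, ← mul_pow]
    norm_num
    left
    congr 1
    ring
  rw [← Finset.sum_congr rfl key, h']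
  linear_combination (-φ (V.mode v s u)) * neg_one_zpow_sq s

theorem sum_skew_choose (y γ : ℂ) (m : ℕ) :
    ∑ j ∈ Finset.range (m + 1), Ring.choose y j * (-1) ^ j * Ring.choose (γ - j) (m - j) =
      Ring.choose (γ - y) m := by
  have h : ∀ j ∈ Finset.range (m + 1),
      Ring.choose y j * (-1) ^ j * Ring.choose (γ - j) (m - j) =
      (-1) ^ m * (Ring.choose y j * Ring.choose (m - γ - 1) (m - j)) := by
    intro j hj
    have hj' : j ≤ m := Nat.lt_succ_iff.1 (Finset.mem_range.1 hj)
    have := choose_neg_eq (j - γ) (m - j)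
    rw [neg_sub, show (j : ℂ) - γ + ((m - j : ℕ) : ℂ) - 1 = m - γ - 1 by
      push_cast [hj']; ring] at this
    rw [this]
    obtain ⟨d, rfl⟩ := Nat.exists_eq_add_of_le hj'
    rw [Nat.add_sub_cancel_left, _root_.pow_add]
    ring_nf
  rw [Finset.sum_congr rfl h, ← Finset.mul_sum, ← vandermonde, ← neg_sub y γ, choose_neg_eq]
  congr 2
  ring

/-- Skew symmetry modulo `O_{g,n}(V)`. -/
theorem Kills.skew (hφ : Kills V g T l i φ) {k k' : ℤ} {u v : V.carrier}
    (hu : u ∈ V.wtSpace k) (hv : v ∈ V.wtSpace k') (y : ℂ) (n : ℤ) :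
    pr φ v u (E y n) = -(-1) ^ n * pr φ u v (E (k + k' - 2 - n - y) n) := by
  obtain ⟨J₁, hJ₁⟩ := exists_mode_eq_zero V v u n
  obtain ⟨J₂, hJ₂⟩ := exists_mode_eq_zero V u v n
  set J := max J₁ J₂
  rw [pr_E φ y n v u (J := J) fun j hj => hJ₁ j (le_trans (le_max_left _ _) hj)]
  have hz : V.rs (E (k + k' - 2 - n - y) n - ∑ j ∈ Finset.range J,
      (Ring.choose y j * (-1) ^ j) • E (k + k' - 2 - n - j) (n + j)) u v = 0 := by
    refine rs_eq_zero V fun e => ?_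
    rw [coeff_sub, coeff_sum]
    rcases lt_or_ge e n with he | he
    · left
      rw [E_coeff_lt _ he, zero_sub, neg_eq_zero]
      exact Finset.sum_eq_zero fun j _ => by rw [coeff_smul, E_coeff_lt _ (by lia), smul_zero]
    obtain ⟨m, rfl⟩ := Int.le.dest he
    rcases le_or_gt J m with hm | hm
    · exact Or.inr (hJ₂ m (le_trans (le_max_right _ _) hm))
    left
    rw [E_coeff_add, ← sum_skew_choose, sub_eq_zero]
    refine Finset.sum_subset_zero_on_sdiff (Finset.range_mono hm) (fun j hj => ?_) fun j hj => ?_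
    · rw [Finset.mem_sdiff, Finset.mem_range, Finset.mem_range] at hj
      rw [coeff_smul, E_coeff_lt _ (by lia), smul_zero]
    · rw [Finset.mem_range] at hj
      obtain ⟨d, rfl⟩ := Nat.exists_eq_add_of_le (Nat.lt_succ_iff.1 hj)
      rw [coeff_smul, show n + ((j + d : ℕ) : ℤ) = n + j + d by push_cast; ring, E_coeff_add,
        Nat.add_sub_cancel_left, smul_eq_mul]
  rw [map_sub, LinearMap.sub_apply, LinearMap.sub_apply, sub_eq_zero] at hz
  rw [pr_apply, hz, ← pr_apply, map_sum, Finset.mul_sum]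
  refine Finset.sum_congr rfl fun j _ => ?_
  rw [hφ.skew_mode hu hv, map_smul, zpow_add₀ (by norm_num), smul_eq_mul]
  push_cast
  rw [zpow_natCast, ← sub_sub]
  ring

end Killing

section Decomposition

variable {V : VOA} {g : VOAAut V} {T : ℕ}

/-- `VOA.proj` as a linear map. -/
def projL (V : VOA) (k : ℤ) : V.carrier →ₗ[ℂ] V.carrier where
  toFun u := V.proj k u
  map_add' u v := by simp [VOA.proj, DirectSum.decompose_add]
  map_smul' c u := by
    rw [VOA.proj, DirectSum.decompose_smul]
    rfl

theorem projL_apply (k : ℤ) (u : V.carrier) : projL V k u = V.proj k u := rfl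

theorem proj_mem (k : ℤ) (u : V.carrier) : V.proj k u ∈ V.wtSpace k := SetLike.coe_mem _

theorem proj_self {k : ℤ} {u : V.carrier} (hu : u ∈ V.wtSpace k) : V.proj k u = u :=
  DirectSum.decompose_of_mem_same V.wtSpace hu

theorem proj_ne {k k' : ℤ} {u : V.carrier} (hu : u ∈ V.wtSpace k) (h : k ≠ k') :
    V.proj k' u = 0 :=
  DirectSum.decompose_of_mem_ne V.wtSpace hu h

theorem proj_support_finite (u : V.carrier) : {k : ℤ | V.proj k u ≠ 0}.Finite := by
  classical
  refine (DFinsupp.support (DirectSum.decompose V.wtSpace u)).finite_toSet.subset fun k hk => ?_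
  simpa [VOA.proj] using hk

theorem map_eq_zero_of_proj {W : Type*} [AddCommGroup W] [Module ℂ W] (ψ : V.carrier →ₗ[ℂ] W)
    (u : V.carrier) (h : ∀ k, ψ (V.proj k u) = 0) : ψ u = 0 := by
  classical
  rw [← DirectSum.sum_support_decompose V.wtSpace u, map_sum]
  exact Finset.sum_eq_zero fun k _ => h k

theorem proj_lin (k : ℤ) (u : V.carrier) : V.proj k (g.lin u) = g.lin (V.proj k u) := by
  have h : ∀ j, V.proj k (g.lin (V.proj j u)) = g.lin (V.proj k (V.proj j u)) := fun j => by
    have h1 := proj_mem j u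
    have h2 := (g.map_wt j _).1 h1
    rcases eq_or_ne j k with rfl | hjk
    · rw [proj_self h1, proj_self h2]
    · rw [proj_ne h1 hjk, proj_ne h2 hjk, map_zero]
  have := map_eq_zero_of_proj (projL V k ∘ₗ g.lin.toLinearMap - g.lin.toLinearMap ∘ₗ projL V k) u
    fun j => by simpa [projL_apply, sub_eq_zero] using h j
  simpa [projL_apply, sub_eq_zero] using this

theorem proj_mem_eigSpace {r : ℕ} {u : V.carrier} (hu : u ∈ eigSpace V g T r) (k : ℤ) :
    V.proj k u ∈ eigSpace V g T r := by
  rw [mem_eigSpace] at *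
  rw [← proj_lin, hu, ← projL_apply, map_smul, projL_apply]

theorem map_eq_zero_of_eigSpace {W : Type*} [AddCommGroup W] [Module ℂ W] (r : ℕ)
    (ψ : V.carrier →ₗ[ℂ] W)
    (h : ∀ k : ℤ, ∀ u ∈ V.wtSpace k, u ∈ eigSpace V g T r → ψ u = 0) {u : V.carrier}
    (hu : u ∈ eigSpace V g T r) : ψ u = 0 :=
  map_eq_zero_of_proj ψ u fun k => h k _ (proj_mem k u) (proj_mem_eigSpace hu k)

/-- `eigProj` as a linear map. -/
def eigProjL (V : VOA) (g : VOAAut V) (T r : ℕ) : V.carrier →ₗ[ℂ] V.carrier where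
  toFun u := eigProj V g T r u
  map_add' u v := by simp [eigProj, Finset.sum_add_distrib]
  map_smul' c u := by
    simp only [eigProj, map_smul, RingHom.id_apply, Finset.smul_sum, smul_smul]
    refine Finset.sum_congr rfl fun t _ => ?_
    congr 1
    ring

theorem eigProjL_apply (r : ℕ) (u : V.carrier) : eigProjL V g T r u = eigProj V g T r u := rfl

theorem eigProj_mem_eigSpace (hT : 0 < T) (hg : g.lin ^ T = 1) (r : ℕ) (u : V.carrier) :
    eigProj V g T r u ∈ eigSpace V g T r := by
  have hT' : (T : ℂ) ≠ 0 := by exact_mod_cast hT.ne'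
  rw [mem_eigSpace]
  set F : ℕ → V.carrier := fun t =>
    Complex.exp ((2 * (Real.pi : ℂ) * Complex.I * (r : ℂ) * (t : ℂ)) / (T : ℂ)) • (g.lin ^ t) u
  have hF : F T = F 0 := by
    simp only [F, hg, pow_zero, Nat.cast_zero, mul_zero, zero_div, Complex.exp_zero]
    congr 1
    rw [mul_div_assoc, div_self hT', mul_one, mul_comm]
    exact Complex.exp_nat_mul_two_pi_mul_I r
  have hsum : ∑ t ∈ Finset.range T, F (t + 1) = ∑ t ∈ Finset.range T, F t := by
    have h1 := Finset.sum_range_succ F T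
    rw [Finset.sum_range_succ', hF] at h1
    exact add_right_cancel h1
  have hstep : ∀ t, g.lin (F t) =
      Complex.exp (-(2 * (Real.pi : ℂ) * Complex.I * (r : ℂ)) / (T : ℂ)) • F (t + 1) := by
    intro t
    simp only [F]
    rw [map_smul, smul_smul, ← Complex.exp_add, pow_succ']
    congr 2
    push_cast
    ring
  change g.lin ((T : ℂ)⁻¹ • ∑ t ∈ Finset.range T, F t) = _ • ((T : ℂ)⁻¹ • ∑ t ∈ Finset.range T, F t)
  rw [map_smul, map_sum, Finset.sum_congr rfl fun t _ => hstep t, ← Finset.smul_sum, hsum, smul_comm]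

theorem sum_exp_eq_zero {t : ℕ} (ht : 0 < t) (htT : t < T) :
    ∑ r ∈ Finset.range T, Complex.exp ((2 * (Real.pi : ℂ) * Complex.I * (r : ℂ) * (t : ℂ)) / (T : ℂ))
      = 0 := by
  have hprim := Complex.isPrimitiveRoot_exp T (by lia)
  set ζ := Complex.exp (2 * Real.pi * Complex.I / T)
  have h : ∀ r : ℕ, Complex.exp ((2 * (Real.pi : ℂ) * Complex.I * (r : ℂ) * (t : ℂ)) / (T : ℂ)) =
      (ζ ^ t) ^ r := fun r => by
    rw [← pow_mul, ← Complex.exp_nat_mul]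
    congr 1
    push_cast
    ring
  simp_rw [h]
  have h1 : ζ ^ t ≠ 1 := hprim.pow_ne_one_of_pos_of_lt ht.ne' htT
  have h2 := geom_sum_mul (ζ ^ t) T
  rw [← pow_mul, mul_comm t, pow_mul, hprim.pow_eq_one, one_pow, sub_self] at h2
  exact (mul_eq_zero.1 h2).resolve_right (sub_ne_zero.2 h1)

theorem sum_eigProj (hT : 0 < T) (u : V.carrier) :
    ∑ r ∈ Finset.range T, eigProj V g T r u = u := by
  have hT' : (T : ℂ) ≠ 0 := by exact_mod_cast hT.ne'
  simp only [eigProj]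
  rw [← Finset.smul_sum, Finset.sum_comm]
  simp_rw [← Finset.sum_smul]
  rw [Finset.sum_eq_single_of_mem 0 (Finset.mem_range.2 hT)]
  · simp [hT']
  · intro t ht ht0
    rw [sum_exp_eq_zero (Nat.pos_of_ne_zero ht0) (Finset.mem_range.1 ht), zero_smul]

theorem eigProj_zero_of_mem (hT : 0 < T) {r : ℕ} (hr : r < T) {u : V.carrier}
    (hu : u ∈ eigSpace V g T r) : eigProj V g T 0 u = if r = 0 then u else 0 := by
  have hT' : (T : ℂ) ≠ 0 := by exact_mod_cast hT.ne'
  have hpow : ∀ t : ℕ, (g.lin ^ t) u =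
      Complex.exp (-((2 * (Real.pi : ℂ) * Complex.I * (t : ℂ) * (r : ℂ)) / (T : ℂ))) • u := by
    intro t
    induction t with
    | zero => simp
    | succ t ih =>
      rw [pow_succ', LinearEquiv.mul_apply, ih, map_smul, mem_eigSpace.1 hu, smul_smul,
        ← Complex.exp_add]
      congr 2
      push_cast
      ring
  simp only [eigProj, hpow]
  split_ifs with h
  · subst h
    simp [← Nat.cast_smul_eq_nsmul ℂ, hT']
  · have h0 := sum_exp_eq_zero (t := T - r) (T := T) (by lia) (by lia)
    have : ∀ t : ℕ, Complex.exp ((2 * (Real.pi : ℂ) * Complex.I * (t : ℂ) * ((T - r : ℕ) : ℂ)) /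
        (T : ℂ)) = Complex.exp (-((2 * (Real.pi : ℂ) * Complex.I * (t : ℂ) * (r : ℂ)) / (T : ℂ))) := by
      intro t
      have h1 := Complex.exp_nat_mul_two_pi_mul_I t
      rw [Nat.cast_sub hr.le, ← mul_one (Complex.exp (-_)), ← h1, ← Complex.exp_add]
      congr 1
      field_simp
      ring
    simp_rw [this] at h0
    simp [smul_smul, ← Finset.sum_smul, h0]

theorem map_eq_zero_of_homogeneous {W : Type*} [AddCommGroup W] [Module ℂ W] (hT : 0 < T)
    (hg : g.lin ^ T = 1) (ψ : V.carrier →ₗ[ℂ] W)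
    (h : ∀ r < T, ∀ k : ℤ, ∀ u ∈ V.wtSpace k, u ∈ eigSpace V g T r → ψ u = 0) (u : V.carrier) :
    ψ u = 0 := by
  rw [← sum_eigProj (g := g) hT u, map_sum]
  exact Finset.sum_eq_zero fun r hr =>
    map_eq_zero_of_eigSpace r ψ (h r (Finset.mem_range.1 hr)) (eigProj_mem_eigSpace hT hg r u)

end Decomposition

section Star

variable {V : VOA} {g : VOAAut V} {T l : ℕ}

/-- The Laurent series defining the product `*_{g,n}` on the weight `k` vectors. -/
def starSer (l : ℕ) (k : ℂ) : LaurentSeries ℂ :=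
  ∑ m ∈ Finset.range (l + 1), ((-1 : ℂ) ^ m * (Nat.choose (m + l) l : ℂ)) •
    E (k + l) (-(l + m + 1 : ℤ))

theorem starFor_eq (k : ℤ) (u v : V.carrier) : starFor V l k u v = V.rs (starSer l k) u v := by
  rw [starFor, starSer, map_sum, LinearMap.sum_apply, LinearMap.sum_apply]
  refine Finset.sum_congr rfl fun m _ => ?_
  rw [res_eq_rs, map_smul, LinearMap.smul_apply, LinearMap.smul_apply]
  push_cast
  rfl

theorem starMul_support_finite (u v : V.carrier) :
    (Function.support fun k : ℤ => V.rs (starSer l k) (eigProjL V g T 0 (projL V k u)) v).Finite :=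
  (proj_support_finite u).subset fun k hk h => hk (by simp [projL_apply, h])

theorem starMul_eq (u v : V.carrier) : starMul V g T l u v =
    ∑ᶠ k : ℤ, V.rs (starSer l k) (eigProjL V g T 0 (projL V k u)) v := by
  simp_rw [starMul, starFor_eq, eigProjL_apply, projL_apply]

/-- The product `*_{g,n}` as a bilinear map. -/
def starMulL (V : VOA) (g : VOAAut V) (T l : ℕ) : V.carrier →ₗ[ℂ] V.carrier →ₗ[ℂ] V.carrier :=
  LinearMap.mk₂ ℂ (fun u v => starMul V g T l u v)
    (fun u u' v => by
      simp only [starMul_eq]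
      rw [← finsum_add_distrib (starMul_support_finite u v) (starMul_support_finite u' v)]
      simp)
    (fun c u v => by
      simp only [starMul_eq]
      rw [smul_finsum' c (starMul_support_finite u v)]
      simp)
    (fun u v v' => by
      simp only [starMul_eq]
      rw [← finsum_add_distrib (starMul_support_finite u v) (starMul_support_finite u v')]
      simp)
    (fun c u v => by
      simp only [starMul_eq]
      rw [smul_finsum' c (starMul_support_finite u v)]
      simp)

theorem starMulL_apply (u v : V.carrier) : starMulL V g T l u v = starMul V g T l u v := rfl

theorem starMul_of_mem (hT : 0 < T) {r : ℕ} (hr : r < T) {k : ℤ} {u : V.carrier}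
    (hu : u ∈ V.wtSpace k) (hur : u ∈ eigSpace V g T r) (v : V.carrier) :
    starMul V g T l u v = if r = 0 then V.rs (starSer l k) u v else 0 := by
  rw [starMul_eq, finsum_eq_single _ k fun j hj => by
    rw [projL_apply, proj_ne hu hj.symm, map_zero, map_zero, LinearMap.zero_apply]]
  rw [projL_apply, proj_self hu, eigProjL_apply, eigProj_zero_of_mem hT hr hur]
  split_ifs <;> simp

end Star

section LeftMultiplication

theorem sum_telescope (l N : ℕ) (X : ℕ → ℂ) :
    ∑ m ∈ Finset.range (N + 1), ((-1 : ℂ) ^ m * (Nat.choose (m + l) l : ℂ)) *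
      (m * X m + (l + m + 1) * X (m + 1)) =
    (-1) ^ N * (Nat.choose (N + l) l : ℂ) * (l + N + 1) * X (N + 1) := by
  induction N with
  | zero => simp
  | succ N ih =>
    have h : (Nat.choose (N + 1 + l) l : ℂ) * (N + 1) = Nat.choose (N + l) l * (l + N + 1) := by
      have := Nat.add_one_mul_choose_eq (N + l) N
      rw [Nat.choose_symm_add,
        show N + l + 1 = N + 1 + l by ring, Nat.choose_symm_add] at this
      have h' : ((N : ℂ) + 1 + l) * Nat.choose (N + l) l = Nat.choose (N + 1 + l) l * (N + 1) := by
        exact_mod_cast this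
      linear_combination -h'
    rw [Finset.sum_range_succ, ih, pow_succ]
    push_cast
    linear_combination -(-1 : ℂ) ^ N * X (N + 1) * h

theorem laurent_smul_mul (c : ℂ) (f g : LaurentSeries ℂ) : (c • f) * g = c • (f * g) := by
  rw [← C_mul_eq_smul, ← C_mul_eq_smul, mul_assoc]

variable {V : VOA} {g : VOAAut V} {T l i : ℕ} {φ : V.carrier →ₗ[ℂ] ℂ}

theorem comm_E (φ : V.carrier →ₗ[ℂ] ℂ) (a b : V.carrier) {J : ℕ}
    (hJ : ∀ j : ℕ, J ≤ j → V.mode a j b = 0) (x y : ℂ) (n m : ℤ) (w : V.carrier) :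
    φ (V.rs (E x n) a (V.rs (E y m) b w)) - φ (V.rs (E y m) b (V.rs (E x n) a w)) =
      ∑ j ∈ Finset.range J, ∑ e ∈ Finset.range (j + 1),
        Ring.choose x e * Ring.choose (n : ℂ) (j - e) *
          pr φ (V.mode a j b) w (E (x - e + y) (n - ((j - e : ℕ) : ℤ) + m)) := by
  rw [← map_sub, rs_comm V a b hJ, map_sum]
  refine Finset.sum_congr rfl fun j _ => ?_
  rw [← pr_apply, E_hasseDeriv, Finset.sum_mul, map_sum]
  refine Finset.sum_congr rfl fun e _ => ?_
  rw [laurent_smul_mul, E_mul, map_smul, smul_eq_mul]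

theorem comm_E_zero (φ : V.carrier →ₗ[ℂ] ℂ) (a b : V.carrier) {J : ℕ}
    (hJ : ∀ j : ℕ, J ≤ j → V.mode a j b = 0) (x y : ℂ) (m : ℤ) (w : V.carrier) :
    φ (V.rs (E x 0) a (V.rs (E y m) b w)) - φ (V.rs (E y m) b (V.rs (E x 0) a w)) =
      ∑ j ∈ Finset.range J, Ring.choose x j * pr φ (V.mode a j b) w (E (x - j + y) m) := by
  rw [← map_sub, rs_comm V a b hJ, map_sum]
  refine Finset.sum_congr rfl fun j _ => ?_
  rw [← pr_apply, E_hasseDeriv_zero, laurent_smul_mul, E_mul, map_smul, smul_eq_mul, zero_add]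

theorem pr_starSer (φ : V.carrier →ₗ[ℂ] ℂ) (u v : V.carrier) (l : ℕ) (k : ℂ) :
    pr φ u v (starSer l k) = ∑ m ∈ Finset.range (l + 1),
      ((-1 : ℂ) ^ m * (Nat.choose (m + l) l : ℂ)) * pr φ u v (E (k + l) (-(l + m + 1 : ℤ))) := by
  rw [starSer, map_sum]
  simp_rw [map_smul, smul_eq_mul]

theorem Kills.star_L_add (hφ : Kills V g T l i φ) (hT : 0 < T) {k : ℤ} {u : V.carrier}
    (hu : u ∈ V.wtSpace k) (hur : u ∈ eigSpace V g T 0) (v : V.carrier) :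
    pr φ (V.mode V.conformal 0 u) v (starSer l (k + 1)) + k * pr φ u v (starSer l k) = 0 := by
  have hg := hφ.gen hT hu hur v
  rw [cexp_zero, pexp_zero] at hg
  have ht := sum_telescope l l fun m => pr φ u v (E (k + l) (-(l + m + 1 : ℤ)))
  have hg' : pr φ u v (E (k + l) (-(l + (l + 1 : ℕ) + 1 : ℤ))) = 0 := by
    rw [← hg]; push_cast; ring_nf
  simp only [hg', mul_zero] at ht
  rw [pr_starSer, pr_starSer, Finset.mul_sum, ← Finset.sum_add_distrib, ← ht]
  refine Finset.sum_congr rfl fun m _ => ?_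
  have h1 := pr_succ φ u v (k + l) (-(l + m + 1 : ℤ) - 1)
  rw [sub_add_cancel] at h1
  rw [show (k : ℂ) + 1 + l = k + l + 1 by ring, pr_L, h1, add_sub_cancel_right]
  push_cast
  rw [show -((l : ℤ) + m + 1) - 1 = -(l + (m + 1) + 1) by ring]
  ring

theorem Kills.apply_rs_L (hφ : Kills V g T l i φ) {k : ℤ} {u : V.carrier}
    (hu : u ∈ V.wtSpace k) (x : ℂ) (n : ℤ) (v : V.carrier) :
    φ (V.rs (E x n) u (V.mode V.conformal 0 v + V.mode V.conformal 1 v)) =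
      -(pr φ (V.mode V.conformal 0 u) v (E (x + 1) n) + k * pr φ u v (E x n)) := by
  obtain ⟨J, hJ⟩ := exists_mode_eq_zero V V.conformal u 0
  have h := comm_E_zero φ V.conformal u (J := J + 2)
    (fun j hj => by simpa using hJ j (by lia)) 1 x n v
  have hE (w : V.carrier) : V.rs (E 1 0) V.conformal w =
      V.mode V.conformal 0 w + V.mode V.conformal 1 w := by
    rw [← zero_add (1 : ℂ), E_succ, map_add, E_zero, E_zero]
    rw [LinearMap.add_apply, LinearMap.add_apply, rs_single, rs_single, zero_add]
  rw [hE, hE, map_add, hφ.L_add, Finset.sum_range_succ', Finset.sum_range_succ',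
    Finset.sum_eq_zero] at h
  · simp only [Nat.cast_zero, Ring.choose_zero_right, zero_add, Nat.cast_one,
      Ring.choose_one_right, V.L0_grading k u hu, sub_zero, sub_self, one_mul] at h
    rw [add_comm 1 x] at h
    have : pr φ ((k : ℂ) • u) v (E x n) = k * pr φ u v (E x n) := by simp [pr_apply]
    rw [this] at h
    linear_combination -h
  · intro j _
    have : Ring.choose (1 : ℂ) (j + 1 + 1) = 0 := by
      have := Ring.choose_natCast (R := ℂ) 1 (j + 1 + 1)
      rw [Nat.cast_one] at this
      rw [this, Nat.choose_eq_zero_of_lt (by lia), Nat.cast_zero]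
    rw [this, zero_mul]

theorem Kills.star_L (hφ : Kills V g T l i φ) (hT : 0 < T) {k : ℤ} {u : V.carrier}
    (hu : u ∈ V.wtSpace k) (hur : u ∈ eigSpace V g T 0) (v : V.carrier) :
    pr φ u (V.mode V.conformal 0 v + V.mode V.conformal 1 v) (starSer l k) = 0 := by
  have h := hφ.star_L_add hT hu hur v
  rw [pr_starSer] at *
  rw [pr_starSer, Finset.mul_sum, ← Finset.sum_add_distrib] at h
  rw [← neg_eq_zero, ← h, ← Finset.sum_neg_distrib]
  refine Finset.sum_congr rfl fun m _ => ?_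
  rw [pr_apply, hφ.apply_rs_L hu, show (k : ℂ) + 1 + l = k + l + 1 by ring]
  ring

theorem Kills.eq_zero_of_pexp_pos (hφ : Kills V g T l i φ) {r : ℕ} (hr₀ : 0 < r) (hr : r < T)
    (hp : 0 < pexp T l i r) {u : V.carrier} (hu : u ∈ eigSpace V g T r) : φ u = 0 := by
  refine map_eq_zero_of_eigSpace r φ (fun k u hu hur => ?_) hu
  have h := hφ.gen hr hu hur V.vacuum
  rw [hφ.skew V.vacuum_wt hu, pr_apply, rs_apply, finsum_eq_single _ (-1) fun n hn => by
    rw [V.vacuum_mode, if_neg hn, smul_zero], V.vacuum_mode, if_pos rfl, map_smul, smul_eq_mul,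
    show (-1 : ℤ) = -(pexp T l i r : ℤ) + (pexp T l i r - 1 : ℕ) by lia, E_coeff_add] at h
  refine (mul_eq_zero.1 ((mul_eq_zero.1 h).resolve_left ?_)).resolve_left (choose_ne_zero ?_)
  · exact neg_ne_zero.2 (zpow_ne_zero _ (by norm_num))
  · intro j _ h
    have hT : (T : ℂ) ≠ 0 := by exact_mod_cast (by lia : T ≠ 0)
    rw [cexp] at h
    have h' : (r : ℂ) = T * ((pexp T l i r : ℤ) - 1 - deltaI T i r - l - j : ℤ) := by
      push_cast at h ⊢
      field_simp at h
      linear_combination -h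
    have h'' : (r : ℤ) = T * ((pexp T l i r : ℤ) - 1 - deltaI T i r - l - j) := by exact_mod_cast h'
    have := Int.le_of_dvd (by lia) ⟨_, h''⟩
    lia

theorem Kills.star_gen (hφ : Kills V g T l i φ) {r : ℕ} (hr : r < T)
    (hp : 0 < pexp T l i r) {w k : ℤ} {a u : V.carrier} (ha : a ∈ V.wtSpace w)
    (har : a ∈ eigSpace V g T 0) (hu : u ∈ V.wtSpace k) (hur : u ∈ eigSpace V g T r)
    (v : V.carrier) :
    pr φ a (V.rs (E (k - 1 + cexp T l i r) (-(pexp T l i r : ℤ))) u v) (starSer l w) = 0 := by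
  rw [pr_starSer]
  refine Finset.sum_eq_zero fun m _ => ?_
  obtain ⟨J, hJ⟩ := exists_mode_eq_zero V a u 0
  have h := comm_E φ a u (J := J) (fun j hj => by simpa using hJ j hj) (w + l)
    (k - 1 + cexp T l i r) (-(l + m + 1 : ℤ)) (-(pexp T l i r : ℤ)) v
  rw [← pr_apply φ u, hφ.gen hr hu hur, sub_zero] at h
  rw [pr_apply, h, mul_eq_zero]
  refine Or.inr (Finset.sum_eq_zero fun j _ => Finset.sum_eq_zero fun e he => ?_)
  have := hφ.gen_shift hr hp (V.mode_grading w k j a u ha hu)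
    (mode_mem_eigSpace_left har hur j) v (l + 1 + (j - e)) (l + 1 + (j - e) + m) (by lia)
  have he : e ≤ j := Nat.lt_succ_iff.1 (Finset.mem_range.1 he)
  rw [mul_eq_zero]
  refine Or.inr (Eq.trans ?_ this)
  congr 2
  · push_cast [Nat.cast_sub he]; ring
  · push_cast [Nat.cast_sub he]; ring

end LeftMultiplication

section BinomialRelations

theorem sum_choose_irrational (d : ℕ) : ∀ {q : ℂ} (_ : ∀ n : ℤ, q ≠ n) (ρ : ℕ → ℂ) (j₀ : ℕ)
    (_ : ∀ j, j₀ ≤ j → ∑ e ∈ Finset.range d, Ring.choose q (j + e) * ρ e = 0),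
    ∀ e < d, ρ e = 0 := by
  induction d with
  | zero => intro _ _ _ _ _ e he; lia
  | succ d ih =>
    intro q hq ρ j₀ h
    have hρ : ∀ e < d, ρ e = 0 := by
      intro e he
      have := ih (q := q + 1) (fun n hn => hq (n - 1) (by push_cast; linear_combination hn))
        (fun e => (d - e) * ρ e) (j₀ + 1) (fun j hj => ?_) e he
      · refine (mul_eq_zero.1 this).resolve_left (sub_ne_zero.2 ?_)
        exact_mod_cast he.ne'
      · obtain ⟨j, rfl⟩ : ∃ j', j = j' + 1 := ⟨j - 1, by lia⟩
        have h1 := h (j + 1) (by lia)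
        have h0 := h j (by lia)
        have : ∑ e ∈ Finset.range (d + 1), Ring.choose (q + 1) (j + 1 + e) * ((d - e) * ρ e) = 0 := by
          calc _ = (j + 1 + d) * ∑ e ∈ Finset.range (d + 1), Ring.choose q (j + 1 + e) * ρ e -
              (q - j - d) * ∑ e ∈ Finset.range (d + 1), Ring.choose q (j + e) * ρ e := by
                rw [Finset.mul_sum, Finset.mul_sum, ← Finset.sum_sub_distrib]
                refine Finset.sum_congr rfl fun e _ => ?_
                have hc := choose_succ_mul q (j + e)
                rw [show j + 1 + e = j + e + 1 by ring, Ring.choose_succ_succ]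
                push_cast at hc
                linear_combination (-ρ e) * hc
            _ = 0 := by rw [h1, h0]; ring
        rw [Finset.sum_range_succ, sub_self, zero_mul, mul_zero, add_zero] at this
        exact this
    intro e he
    rcases Nat.lt_succ_iff_lt_or_eq.1 he with he | rfl
    · exact hρ e he
    · have := h j₀ le_rfl
      rw [Finset.sum_range_succ, Finset.sum_eq_zero fun e' he' => by
        rw [hρ e' (Finset.mem_range.1 he'), mul_zero], zero_add] at this
      exact (mul_eq_zero.1 this).resolve_left (choose_ne_zero fun k _ => by exact_mod_cast hq k)

theorem sum_choose_consecutive (d : ℕ) : ∀ (x : ℂ) (w : ℕ → ℂ)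
    (_ : ∀ n < d, ∑ i ∈ Finset.range d, Ring.choose (x + n) i * w i = 0), ∀ i < d, w i = 0 := by
  induction d with
  | zero => intro _ _ _ i hi; lia
  | succ d ih =>
    intro x w h
    have hw : ∀ i < d, w (i + 1) = 0 := ih x (fun i => w (i + 1)) fun n hn => by
      have h1 := h (n + 1) (by lia)
      have h0 := h n (by lia)
      rw [Finset.sum_range_succ'] at h0 h1
      have : ∑ i ∈ Finset.range d, Ring.choose (x + n) i * w (i + 1) =
          ∑ i ∈ Finset.range d, Ring.choose (x + (n + 1 : ℕ)) (i + 1) * w (i + 1) -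
          ∑ i ∈ Finset.range d, Ring.choose (x + n) (i + 1) * w (i + 1) := by
        rw [← Finset.sum_sub_distrib]
        refine Finset.sum_congr rfl fun i _ => ?_
        rw [Nat.cast_succ, ← add_assoc, Ring.choose_succ_succ]
        ring
      rw [this]
      simp only [Ring.choose_zero_right] at h0 h1
      linear_combination h1 - h0
    intro i hi
    cases i with
    | succ i => exact hw i (by lia)
    | zero =>
      have := h 0 (by lia)
      rw [Finset.sum_range_succ', Finset.sum_eq_zero fun i hi => by
        rw [hw i (Finset.mem_range.1 hi), mul_zero]] at this
      simpa using this

end BinomialRelations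

section Critical

variable {V : VOA} {g : VOAAut V} {T l i : ℕ} {φ : V.carrier →ₗ[ℂ] ℂ}

theorem pr_E_add (φ : V.carrier →ₗ[ℂ] ℂ) (x y : ℂ) (n : ℤ) (u v : V.carrier) {J : ℕ}
    (h : ∀ j : ℕ, J ≤ j → V.mode u (n + j) v = 0) :
    pr φ u v (E (y + x) n) = ∑ e ∈ Finset.range J, Ring.choose y e * pr φ u v (E x (n + e)) := by
  cases J with
  | zero => rw [pr_E φ _ n u v h, Finset.sum_range_zero, Finset.sum_range_zero]
  | succ J =>
    rw [pr_E φ _ n u v h]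
    have h1 : ∀ t ∈ Finset.range (J + 1), Ring.choose (y + x) t * φ (V.mode u (n + t) v) =
        ∑ e ∈ Finset.range (J + 1), if e ≤ t then
          Ring.choose y e * Ring.choose x (t - e) * φ (V.mode u (n + t) v) else 0 := by
      intro t ht
      rw [← vandermonde_of_le y x (Nat.lt_succ_iff.1 (Finset.mem_range.1 ht)), Finset.sum_mul]
      exact Finset.sum_congr rfl fun e _ => by split_ifs <;> simp
    rw [Finset.sum_congr rfl h1, Finset.sum_comm]
    refine Finset.sum_congr rfl fun e he => ?_
    obtain ⟨d, hd⟩ : ∃ d, J + 1 = e + d := ⟨J + 1 - e, by have := Finset.mem_range.1 he; lia⟩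
    rw [hd, Finset.sum_range_add, Finset.sum_eq_zero fun t ht => if_neg (by
        have := Finset.mem_range.1 ht; lia), zero_add,
      pr_E φ x (n + e) u v (J := d) fun j hj => by
        have := h (e + j) (by lia)
        rwa [Nat.cast_add, ← add_assoc] at this, Finset.mul_sum]
    refine Finset.sum_congr rfl fun j _ => ?_
    rw [if_pos (by lia), Nat.add_sub_cancel_left, Nat.cast_add, ← add_assoc, mul_assoc]

/-- The sectors `0 < r < T` in which the generators `u ∘ v` have no pole. -/
structure Crit (T l i r : ℕ) : Prop where
  pos : 0 < r
  lt : r < T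
  pexp_eq : pexp T l i r = 0

theorem Crit.l_eq {r : ℕ} (h : Crit T l i r) : l = 0 := by
  have := h.pexp_eq; rw [pexp] at this; lia

theorem Crit.cexp_eq {r : ℕ} (h : Crit T l i r) : cexp T l i r = r / T := by
  have := h.pexp_eq
  rw [pexp] at this
  rw [cexp, h.l_eq, show deltaI T i r = 0 by lia]
  simp

theorem Crit.symm {r : ℕ} (h : Crit T l i r) : Crit T l i (T - r) := by
  have h1 := h.pos
  have h2 := h.lt
  refine ⟨by lia, by lia, ?_⟩
  have := h.pexp_eq
  rw [pexp] at *
  rw [Nat.sub_sub_self h2.le]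
  lia

theorem div_ne_intCast {r : ℕ} (h₀ : 0 < r) (h : r < T) (n : ℤ) : (r : ℂ) / T ≠ n := by
  intro hn
  have hT : (T : ℂ) ≠ 0 := by exact_mod_cast (by lia : T ≠ 0)
  rw [div_eq_iff hT] at hn
  have h' : (r : ℤ) = T * n := by
    have : (r : ℂ) = T * n := by rw [hn, mul_comm]
    exact_mod_cast this
  have := Int.le_of_dvd (by lia) ⟨_, h'⟩
  lia

theorem cexp_ne_intCast {r : ℕ} (h₀ : 0 < r) (h : r < T) (n : ℤ) : cexp T l i r ≠ n := by
  intro hn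
  refine div_ne_intCast h₀ h (n - deltaI T i r - l) ?_
  push_cast
  rw [cexp] at hn
  linear_combination hn

theorem choose_intCast_add_ne_zero {q : ℂ} (hq : ∀ n : ℤ, q ≠ n) (m : ℤ) (j : ℕ) :
    Ring.choose (m + q) j ≠ 0 :=
  choose_ne_zero fun k _ h => hq (k - m) (by push_cast; linear_combination h)

/-- Every generator with trivial pole gives, by skew-symmetry, a relation for the action of the
fixed points on a critical sector. -/
theorem Kills.crit_skew (hφ : Kills V g T l i φ) {s : ℕ} (hs : Crit T l i s) {w : ℤ}
    {b m : V.carrier} (hb : b ∈ V.wtSpace w) (hm : m ∈ eigSpace V g T s) :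
    pr φ b m (E (w - 1 - s / T) 0) = 0 := by
  refine map_eq_zero_of_eigSpace s (φ ∘ₗ V.rs (E (w - 1 - s / T) 0) b) (fun k u hu hus => ?_) hm
  have h := hφ.gen hs.lt hu hus b
  rw [hs.cexp_eq, hs.pexp_eq, hφ.skew hb hu] at h
  rw [LinearMap.comp_apply, ← pr_apply]
  refine Eq.trans ?_ ((mul_eq_zero.1 h).resolve_left
    (neg_ne_zero.2 (zpow_ne_zero _ (by norm_num))))
  congr 2
  push_cast
  ring

theorem Kills.fixed_pole (hφ : Kills V g T l i φ) (hT : 0 < T) (hl : l = 0) {w : ℤ}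
    {b : V.carrier} (hb : b ∈ V.wtSpace w) (hb' : b ∈ eigSpace V g T 0) (m : V.carrier) (N n : ℕ)
    (hN : N ≤ n) : pr φ b m (E (w + N) (-(2 + n : ℤ))) = 0 := by
  have h := hφ.gen_shift hT (by rw [pexp_zero]; lia) hb hb' m N n hN
  rw [cexp_zero, pexp_zero, hl] at h
  rw [← h]
  push_cast
  ring_nf

/-- The commutator of the conformal vector with the relations `fixed_pole`. -/
theorem Kills.crit_recursion (hφ : Kills V g T l i φ) {s : ℕ} (hs : Crit T l i s) {w : ℤ}
    {b m : V.carrier} (hb : b ∈ V.wtSpace w) (hb' : b ∈ eigSpace V g T 0)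
    (hm : m ∈ eigSpace V g T s) {J : ℕ} (hJ : ∀ j : ℕ, J ≤ j → V.mode V.conformal j b = 0)
    (e : ℕ) :
    ∑ j ∈ Finset.range J, Ring.choose (1 - s / T : ℂ) j *
      pr φ (V.mode V.conformal j b) m (E ((w + 1 - j : ℤ) : ℂ) (e - 1)) = 0 := by
  have hT := hs.pos.trans hs.lt
  have hq : ∀ n : ℤ, -(s / T : ℂ) ≠ n := fun n h =>
    div_ne_intCast hs.pos hs.lt (-n) (by push_cast; linear_combination -h)
  have hwt (j : ℕ) : V.mode V.conformal j b ∈ V.wtSpace (w + 1 - j) := by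
    have := V.mode_grading 2 w j _ b V.conformal_wt hb
    rwa [show 2 + w - (j : ℤ) - 1 = w + 1 - j by ring] at this
  have heig (j : ℕ) : V.mode V.conformal j b ∈ eigSpace V g T 0 :=
    mode_mem_eigSpace_left conformal_mem_eigSpace hb' j
  obtain ⟨N, hN⟩ : ∃ N : ℕ, ∀ j < J, ∀ n : ℕ, N ≤ n →
      V.mode (V.mode V.conformal j b) (-1 + n) m = 0 := by
    choose N hN using fun j : ℕ => exists_mode_eq_zero V (V.mode V.conformal j b) m (-1)
    exact ⟨(Finset.range J).sup N, fun j hj n hn =>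
      hN j n ((Finset.le_sup (Finset.mem_range.2 hj)).trans hn)⟩
  set D := max N (e + 1)
  refine sum_choose_irrational D hq (fun e => ∑ j ∈ Finset.range J, Ring.choose (1 - s / T : ℂ) j *
    pr φ (V.mode V.conformal j b) m (E ((w + 1 - j : ℤ) : ℂ) (e - 1))) 1 (fun j hj => ?_) e (by lia)
  obtain ⟨ι, rfl⟩ : ∃ ι, j = ι + 1 := ⟨j - 1, by lia⟩
  have h := comm_E_zero φ V.conformal b hJ (1 - s / T) w (-(2 + ι : ℤ)) m
  have h1 := hφ.crit_skew hs V.conformal_wt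
    (m := V.rs (E w (-(2 + ι : ℤ))) b m) (rs_mem _ fun n => mode_mem_eigSpace_left hb' hm n)
  have h2 := hφ.fixed_pole hT hs.l_eq hb hb' (V.rs (E (1 - s / T) 0) V.conformal m) 0 ι (by lia)
  rw [pr_apply] at h1 h2
  rw [show ((2 : ℤ) : ℂ) - 1 - s / T = 1 - s / T by norm_num] at h1
  rw [Nat.cast_zero, add_zero] at h2
  rw [h1, h2, sub_zero] at h
  rw [h]
  simp_rw [Finset.mul_sum]
  rw [Finset.sum_comm]
  refine Finset.sum_congr rfl fun j hj => ?_
  have hj := Finset.mem_range.1 hj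
  rw [show (1 - s / T - j + w : ℂ) = -(s / T) + ((w + 1 - j : ℤ) : ℂ) by push_cast; ring,
    pr_E_add (J := ι + 1 + D) φ _ _ _ _ _ fun f hf => by
      have := hN j hj (f - (ι + 1)) (by lia)
      rwa [show -1 + ((f - (ι + 1) : ℕ) : ℤ) = -(2 + ι) + f by lia] at this,
    Finset.sum_range_add, Finset.sum_eq_zero (s := Finset.range (ι + 1)) fun f hf => ?_, zero_add,
    Finset.mul_sum]
  · refine Finset.sum_congr rfl fun f _ => ?_
    rw [show -(2 + ι : ℤ) + ((ι + 1 + f : ℕ) : ℤ) = f - 1 by push_cast; ring]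
    ring
  · have hf := Finset.mem_range.1 hf
    have := hφ.fixed_pole hT hs.l_eq (hwt j) (heig j) m 0 (ι - f) (by lia)
    rw [Nat.cast_zero, add_zero, show -(2 + ((ι - f : ℕ) : ℤ)) = -(2 + ι) + f by lia] at this
    rw [this, mul_zero]

theorem wt_induction (V : VOA) {P : ℤ → Prop} (h₀ : ∀ w, V.wtSpace w = ⊥ → P w)
    (h : ∀ w, (∀ w' < w, P w') → P w) (w : ℤ) : P w := by
  obtain ⟨w₀, hw₀⟩ := V.bounded_below
  suffices H : ∀ n : ℕ, ∀ w, w < w₀ + n → P w from H (w + 1 - w₀).toNat w (by lia)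
  intro n
  induction n with
  | zero => exact fun w hw => h₀ w (hw₀ w (by lia))
  | succ n ih => exact fun w hw => h w fun w' hw' => ih w' (by lia)

theorem Kills.fixed_crit (hφ : Kills V g T l i φ) {s : ℕ} (hs : Crit T l i s) {m : V.carrier}
    (hm : m ∈ eigSpace V g T s) (w : ℤ) :
    ∀ b ∈ V.wtSpace w, b ∈ eigSpace V g T 0 → ∀ e : ℕ, pr φ b m (E w e) = 0 := by
  refine wt_induction V
    (P := fun w => ∀ b ∈ V.wtSpace w, b ∈ eigSpace V g T 0 → ∀ e : ℕ, pr φ b m (E w e) = 0)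
    (fun w hw b hb _ e => ?_) (fun w ih b hb hb' e => ?_) w
  · rw [hw, Submodule.mem_bot] at hb
    rw [pr_apply, hb]
    simp
  obtain ⟨D, hD⟩ := exists_mode_eq_zero V b m 0
  obtain ⟨J, hJ⟩ := exists_mode_eq_zero V V.conformal b 0
  suffices H : ∀ d e : ℕ, D ≤ e + d → pr φ b m (E w e) = 0 from H D e (by lia)
  intro d
  induction d with
  | zero =>
    intro e he
    rw [pr_E φ _ _ _ _ (J := 0) fun j _ => by simpa using hD (e + j) (by lia),
      Finset.sum_range_zero]
  | succ d ihd =>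
    intro e he
    have h := hφ.crit_recursion hs hb hb' hm (J := J + 2)
      (fun j hj => by simpa using hJ j (by lia)) (e + 2)
    rw [Finset.sum_range_succ', Finset.sum_range_succ', Finset.sum_eq_zero, zero_add] at h
    · have h1 := ihd (e + 1) (by lia)
      have h2 := pr_succ φ b m w e
      have hL := pr_L φ b m (w + 1) (e + 1)
      rw [show ((e + 2 : ℕ) : ℤ) - 1 = e + 1 by push_cast; ring] at h
      rw [add_sub_cancel_right, add_sub_cancel_right, h2] at hL
      have hb1 : pr φ ((w : ℂ) • b) m (E w (e + 1)) = w * pr φ b m (E w (e + 1)) := by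
        simp [pr_apply]
      simp only [zero_add, Nat.cast_zero, Nat.cast_one, sub_zero, Int.cast_add, Int.cast_one,
        Ring.choose_zero_right, one_mul, hL, V.L0_grading w b hb, add_sub_cancel_right, hb1] at h
      push_cast at h1
      rw [h1] at h
      have he : (e + 1 : ℂ) ≠ 0 := by exact_mod_cast e.succ_ne_zero
      refine (mul_eq_zero.1 (?_ : (e + 1 : ℂ) * _ = 0)).resolve_left he
      push_cast at h
      linear_combination -h
    · intro j _
      have := ih (w + 1 - (j + 1 + 1 : ℕ)) (by lia)
        (V.mode V.conformal (j + 1 + 1 : ℕ) b) (by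
          have := V.mode_grading 2 w (j + 1 + 1 : ℕ) _ b V.conformal_wt hb
          rwa [show 2 + w - ((j + 1 + 1 : ℕ) : ℤ) - 1 = w + 1 - (j + 1 + 1 : ℕ) by ring] at this)
        (mode_mem_eigSpace_left conformal_mem_eigSpace hb' _) (e + 1)
      rw [show ((e + 2 : ℕ) : ℤ) - 1 = (e + 1 : ℕ) by push_cast; ring, this, mul_zero]

/-- Only the weight zero component of a critical sector survives modulo `O_{g,n}(V)`. -/
theorem Kills.crit_eq_zero (hφ : Kills V g T l i φ) {s : ℕ} (hs : Crit T l i s) {k : ℤ}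
    (hk : k ≠ 0) {m : V.carrier} (hm : m ∈ V.wtSpace k) (hms : m ∈ eigSpace V g T s) :
    φ m = 0 := by
  obtain ⟨D, hD⟩ := exists_mode_eq_zero V V.conformal m 1
  have h := pr_E_add φ (2 : ℤ) (-(2 : ℤ)) 1 V.conformal m hD
  rw [Finset.sum_eq_zero fun e _ => ?_, neg_add_cancel, pr_E_zero, V.L0_grading k m hm,
    map_smul, smul_eq_mul] at h
  · exact (mul_eq_zero.1 h).resolve_left (by exact_mod_cast hk)
  · have := hφ.fixed_crit hs hms 2 _ V.conformal_wt conformal_mem_eigSpace (1 + e)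
    push_cast at this ⊢
    rw [this, mul_zero]

end Critical

section CriticalLanding

variable {V : VOA} {g : VOAAut V} {T l i : ℕ} {φ : V.carrier →ₗ[ℂ] ℂ}

theorem mode_mem_crit {r t s : ℕ} (hs : Crit T l i s) (hrt : (r + t) % T = s) {u y : V.carrier}
    (hu : u ∈ eigSpace V g T r) (hy : y ∈ eigSpace V g T t) (n : ℤ) :
    V.mode u n y ∈ eigSpace V g T s := by
  rw [← hrt, eigSpace_mod (hs.pos.trans hs.lt)]
  exact mode_mem_eigSpace hu hy n

theorem Kills.pr_crit (hφ : Kills V g T l i φ) {s : ℕ} (hs : Crit T l i s) {k k' : ℤ}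
    {u y : V.carrier} (hu : u ∈ V.wtSpace k) (hy : y ∈ V.wtSpace k')
    (huy : ∀ n, V.mode u n y ∈ eigSpace V g T s) (x : ℂ) {n : ℤ} {j : ℕ} (hj : k + k' - 1 = n + j) :
    pr φ u y (E x n) = Ring.choose x j * φ (V.mode u (n + j) y) := by
  obtain ⟨J, hJ⟩ := exists_mode_eq_zero V u y n
  rw [pr_E φ x n u y (J := J + (j + 1)) fun e he => hJ e (by lia),
    Finset.sum_eq_single_of_mem j (by simp; lia)]
  intro e _ he
  rw [hφ.crit_eq_zero hs (k := k + k' - (n + e) - 1) (by lia) (V.mode_grading _ _ _ _ _ hu hy)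
    (huy _), mul_zero]

/-- To kill a mode landing in a critical sector, it suffices to find a residue with nonzero
coefficient at this mode. -/
theorem Kills.crit_mode_of_pr (hφ : Kills V g T l i φ) {r t s : ℕ} (hs : Crit T l i s)
    (hrt : (r + t) % T = s) {k : ℤ} {u y : V.carrier} (hu : u ∈ V.wtSpace k)
    (hur : u ∈ eigSpace V g T r) (hy : y ∈ eigSpace V g T t) (n : ℤ)
    (h : ∀ k', ∀ v ∈ V.wtSpace k', v ∈ eigSpace V g T t → ∃ (x : ℂ) (j : ℕ),
      Ring.choose x j ≠ 0 ∧ pr φ u v (E x (n - j)) = 0) : φ (V.mode u n y) = 0 := by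
  refine map_eq_zero_of_eigSpace t (φ ∘ₗ V.mode u n) (fun k' v hv hvt => ?_) hy
  have huv := mode_mem_crit hs hrt hur hvt
  rw [LinearMap.comp_apply]
  by_cases hk : k + k' - n - 1 = 0
  · obtain ⟨x, j, hx, h0⟩ := h k' v hv hvt
    rw [hφ.pr_crit hs hu hv huv x (j := j) (by lia), sub_add_cancel] at h0
    exact (mul_eq_zero.1 h0).resolve_left hx
  · exact hφ.crit_eq_zero hs hk (V.mode_grading _ _ _ _ _ hu hv) (huv n)

theorem Kills.crit_mode_fixed (hφ : Kills V g T l i φ) {s : ℕ} (hs : Crit T l i s)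
    {k : ℤ} {u y : V.carrier} (hu : u ∈ V.wtSpace k)
    (hur : u ∈ eigSpace V g T 0) (hy : y ∈ eigSpace V g T s) {n : ℤ} (hn : n ≠ -1 ∨ k ≠ 0) :
    φ (V.mode u n y) = 0 := by
  have hT := hs.pos.trans hs.lt
  refine hφ.crit_mode_of_pr hs (by rw [zero_add, Nat.mod_eq_of_lt hs.lt]) hu hur hy n
    fun k' v hv hvt => ?_
  have hp := hφ.fixed_pole hT hs.l_eq hu hur v 0
  simp only [Nat.cast_zero, add_zero, Nat.zero_le, forall_const] at hp
  rcases lt_trichotomy n (-1) with h | rfl | h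
  · refine ⟨k, 0, by simp, ?_⟩
    rw [← hp (-n - 2).toNat]
    congr 2
    lia
  · refine ⟨k, 1, ?_, ?_⟩
    · rw [Ring.choose_one_right]
      exact_mod_cast hn.resolve_left (by simp)
    · rw [← hp 0]
      rfl
  · obtain ⟨j, rfl⟩ := Int.eq_ofNat_of_zero_le (by lia : 0 ≤ n)
    refine ⟨k - 1 - s / T, j, ?_, ?_⟩
    · have := choose_intCast_add_ne_zero (q := -(s / T : ℂ)) (fun n h =>
        div_ne_intCast hs.pos hs.lt (-n) (by push_cast; linear_combination -h)) (k - 1) j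
      push_cast at this
      rwa [← sub_eq_add_neg] at this
    · rw [sub_self]
      exact hφ.crit_skew hs hu hvt

theorem Kills.crit_mode_pole (hφ : Kills V g T l i φ) {r t s : ℕ} (hs : Crit T l i s)
    (hr₀ : 0 < r) (hr : r < T) (hp : 0 < pexp T l i r)
    (hrt : (r + t) % T = s) {k : ℤ} {u y : V.carrier} (hu : u ∈ V.wtSpace k)
    (hur : u ∈ eigSpace V g T r) (hy : y ∈ eigSpace V g T t) (n : ℤ) : φ (V.mode u n y) = 0 := by
  refine hφ.crit_mode_of_pr hs hrt hu hur hy n fun k' v hv hvt => ?_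
  rcases le_or_gt n (-(pexp T l i r : ℤ)) with h | h
  · refine ⟨k - 1 + cexp T l i r, 0, by simp, ?_⟩
    have := hφ.gen_shift hr hp hu hur v 0 (-n - pexp T l i r).toNat (by lia)
    rw [Nat.cast_zero, add_zero] at this
    rw [← this]
    congr 2
    lia
  · obtain ⟨j, hj⟩ := Int.eq_ofNat_of_zero_le (by lia : 0 ≤ n + pexp T l i r)
    refine ⟨k - 1 + cexp T l i r, j, ?_, ?_⟩
    · have := choose_intCast_add_ne_zero (cexp_ne_intCast (l := l) (i := i) hr₀ hr) (k - 1) j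
      push_cast at this
      exact this
    · rw [← hφ.gen hr hu hur v]
      congr 2
      lia

theorem Kills.crit_mode_nonneg (hφ : Kills V g T l i φ) {r t s : ℕ} (hs : Crit T l i s)
    (hr : Crit T l i r) (hrt : (r + t) % T = s) {k : ℤ} {u y : V.carrier} (hu : u ∈ V.wtSpace k)
    (hur : u ∈ eigSpace V g T r) (hy : y ∈ eigSpace V g T t) (n : ℕ) :
    φ (V.mode u n y) = 0 := by
  refine hφ.crit_mode_of_pr hs hrt hu hur hy n fun k' v hv hvt => ?_
  refine ⟨k - 1 + cexp T l i r, n, ?_, ?_⟩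
  · have := choose_intCast_add_ne_zero (cexp_ne_intCast (l := l) (i := i) hr.pos hr.lt) (k - 1) n
    push_cast at this
    exact this
  · rw [← hφ.gen hr.lt hu hur v, hr.pexp_eq, sub_self]
    rfl

theorem Kills.crit_mode_mode (hφ : Kills V g T l i φ) {r t s : ℕ} (hs : Crit T l i s)
    (hr : Crit T l i r) (hrt : (r + t) % T = s) {w k : ℤ} {a u y : V.carrier}
    (ha : a ∈ V.wtSpace w) (ha' : a ∈ eigSpace V g T 0) (hu : u ∈ V.wtSpace k)
    (hur : u ∈ eigSpace V g T r) (hy : y ∈ eigSpace V g T t) (e : ℕ) (n : ℤ) :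
    φ (V.mode (V.mode a e u) n y) = 0 := by
  obtain ⟨J, hJ⟩ := exists_mode_eq_zero V a u 0
  have key := sum_choose_consecutive (J + e + 1)
    (((min (-2) (n + e)) - (J + e + 1 : ℕ) : ℤ) : ℂ)
    (fun j => φ (V.mode (V.mode a j u) (n + e - j) y)) (fun d hd => ?_) e (by lia)
  · simpa using key
  · set p : ℤ := (min (-2) (n + e)) - (J + e + 1 : ℕ) + d with hpd
    have h := congrArg φ (mode_comm V a u y (J := J + e + 1)
      (fun j hj => by simpa using hJ j (by lia)) p (n + e - p))
    obtain ⟨c, hc⟩ := Int.eq_ofNat_of_zero_le (by lia : 0 ≤ n + e - p)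
    rw [map_sub, hc, hφ.crit_mode_nonneg hs hr hrt hu hur (mode_mem_eigSpace_left ha' hy p),
      hφ.crit_mode_fixed hs ha ha' (mode_mem_crit hs hrt hur hy _) (Or.inl (by lia)), sub_zero,
      map_sum] at h
    rw [h]
    refine Finset.sum_congr rfl fun j _ => ?_
    rw [map_smul, smul_eq_mul, ← hc, hpd]
    push_cast
    ring_nf

theorem Kills.crit_mode (hφ : Kills V g T l i φ) {r t s : ℕ} (hs : Crit T l i s)
    (hr : Crit T l i r) (hrt : (r + t) % T = s) {k : ℤ} {u y : V.carrier} (hu : u ∈ V.wtSpace k)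
    (hur : u ∈ eigSpace V g T r) (hy : y ∈ eigSpace V g T t) {n : ℤ} (hn : n ≠ -1 ∨ k ≠ 0) :
    φ (V.mode u n y) = 0 := by
  have h := hφ.crit_mode_mode hs hr hrt V.conformal_wt conformal_mem_eigSpace hu hur hy
  have h0 := h 0 (n + 1)
  have h1 := h 1 n
  rw [Nat.cast_zero, V.Lneg1_mode, LinearMap.smul_apply, map_smul, smul_eq_mul,
    add_sub_cancel_right, mul_eq_zero] at h0
  rw [Nat.cast_one, V.L0_grading k u hu, map_smul, Pi.smul_apply, LinearMap.smul_apply, map_smul,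
    smul_eq_mul, mul_eq_zero] at h1
  rcases hn with hn | hn
  · exact h0.resolve_left (neg_ne_zero.2 (by exact_mod_cast (by lia : n + 1 ≠ 0)))
  · exact h1.resolve_left (by exact_mod_cast hn)

end CriticalLanding

section FixedLanding

variable {V : VOA} {g : VOAAut V} {T l i : ℕ} {φ : V.carrier →ₗ[ℂ] ℂ}

theorem choose_add_nat (x : ℂ) (D : ℕ) : ∀ (m M : ℕ) (_ : D < M), Ring.choose (x + D) (m + D) =
    ∑ s ∈ Finset.range M, (D.choose s : ℂ) * Ring.choose x (m + s) := by
  induction D with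
  | zero =>
    intro m M hM
    rw [Finset.sum_eq_single_of_mem 0 (by simpa using hM)]
    · simp
    · intro s _ hs
      rw [Nat.choose_eq_zero_of_lt (by lia), Nat.cast_zero, zero_mul]
  | succ D ih =>
    intro m M hM
    obtain ⟨M, rfl⟩ : ∃ M', M = M' + 1 := ⟨M - 1, by lia⟩
    have h1 := ih m (M + 1) (by lia)
    have h2 : Ring.choose (x + D) (m + 1 + D) =
        ∑ s ∈ Finset.range M, (D.choose s : ℂ) * Ring.choose x (m + (s + 1)) :=
      (ih (m + 1) M (by lia)).trans
        (Finset.sum_congr rfl fun s _ => by rw [show m + 1 + s = m + (s + 1) by ring])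
    rw [Finset.sum_range_succ'] at h1
    rw [Finset.sum_range_succ', Nat.cast_succ, ← add_assoc, ← add_assoc, Ring.choose_succ_succ, h1,
      show m + D + 1 = m + 1 + D by ring, h2]
    simp_rw [Nat.choose_succ_succ' D, Nat.cast_add, add_mul, Finset.sum_add_distrib]
    simp only [Nat.choose_zero_right, Nat.cast_one]
    ring

theorem choose_mul_choose_shift (q : ℂ) (n d : ℕ) :
    Ring.choose (-1 - n : ℂ) d * Ring.choose (q + d) (n + d) =
      (-1) ^ d * Ring.choose (q + d) d * Ring.choose q n := by
  have h := choose_mul_choose (q + d) d n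
  rw [add_sub_cancel_right] at h
  rw [show (-1 - n : ℂ) = -(n + 1) by ring, choose_neg_eq, mul_assoc ((-1) ^ d) (Ring.choose (q + d) d), h,
    show (n : ℂ) + 1 + d - 1 = ((n + d : ℕ) : ℂ) by push_cast; ring, Ring.choose_natCast]
  ring

theorem coeff_eq_zero_of_sum_choose {q : ℂ} (hq : ∀ n : ℤ, q ≠ n) (D : ℕ) : ∀ (κ : ℕ → ℂ) (c : ℂ)
    (_ : ∀ m : ℕ, ∑ d ∈ Finset.range D, κ d * Ring.choose (q + d) (m + 2 + d) +
      c * Ring.choose (q - 1) m = 0), ∀ d < D, κ d = 0 := by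
  induction D with
  | zero => intro _ _ _ d hd; lia
  | succ D ih =>
    intro κ c h
    have hD : κ D = 0 := by
      have := sum_choose_irrational (D + 3) (q := q - 1)
        (fun n hn => hq (n + 1) (by push_cast; linear_combination hn))
        (fun s => if s = 0 then c else
          ∑ d ∈ Finset.range (D + 1), κ d * ((d + 1).choose (s - 1) : ℂ)) 0 (fun m _ => ?_)
        (D + 2) (by lia)
      · rw [if_neg (by lia), Finset.sum_range_succ, Finset.sum_eq_zero fun d hd => by
          rw [Nat.choose_eq_zero_of_lt (by have := Finset.mem_range.1 hd; lia), Nat.cast_zero,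
            mul_zero]] at this
        simpa using this
      · rw [← h m, Finset.sum_range_succ']
        simp only [if_true, add_zero, Nat.add_eq_zero_iff, one_ne_zero, and_false, if_false,
          Nat.add_sub_cancel, Finset.mul_sum]
        rw [Finset.sum_comm, mul_comm c]
        congr 1
        refine Finset.sum_congr rfl fun d hd => ?_
        have := choose_add_nat (q - 1) (d + 1) (m + 1) (D + 2)
          (by have := Finset.mem_range.1 hd; lia)
        rw [show q - 1 + ((d + 1 : ℕ) : ℂ) = q + d by push_cast; ring,
          show m + 1 + (d + 1) = m + 2 + d by ring] at this
        rw [this, Finset.mul_sum]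
        refine Finset.sum_congr rfl fun s _ => ?_
        rw [show m + (s + 1) = m + 1 + s by ring]
        ring
    intro d hd
    rcases Nat.lt_succ_iff_lt_or_eq.1 hd with hd | rfl
    · refine ih κ c (fun m => ?_) d hd
      have := h m
      rwa [Finset.sum_range_succ, hD, zero_mul, add_zero] at this
    · exact hD

theorem pr_mix {x q C : ℂ} {u v : V.carrier}
    (h : ∀ m : ℕ, pr φ u v (E x (-(m + 1 : ℤ))) = C * Ring.choose (q - 1) m) (N : ℕ) :
    ∀ m : ℕ, pr φ u v (E (x + N) (-(N + 1 + m : ℤ))) = C * Ring.choose (q - 1 + N) (N + m) := by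
  induction N with
  | zero =>
    intro m
    simpa [add_comm] using h m
  | succ N ih =>
    intro m
    have h1 := ih (m + 1)
    have h2 := ih m
    rw [Nat.cast_succ, ← add_assoc, pr_succ, ← add_assoc, show N + 1 + m = N + m + 1 by ring,
      Ring.choose_succ_succ, mul_add, ← h2]
    rw [show N + m + 1 = N + (m + 1) by ring, ← h1]
    push_cast
    ring_nf

theorem pr_mix_zero {x : ℂ} {u v : V.carrier}
    (h : ∀ m : ℕ, pr φ u v (E x (-(m : ℤ))) = 0) (N : ℕ) :
    ∀ m : ℕ, pr φ u v (E (x + N) (-(N + m : ℤ))) = 0 := by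
  induction N with
  | zero =>
    intro m
    simpa using h m
  | succ N ih =>
    intro m
    have h1 := ih (m + 1)
    have h2 := ih m
    rw [Nat.cast_succ, ← add_assoc, pr_succ, ← add_zero (0 : ℂ)]
    nth_rw 1 [← h1]
    rw [← h2]
    push_cast
    ring_nf

/-- Solution of the recursion satisfied by the residues landing in the fixed points. -/
theorem mix_recursion {k : ℤ} {q γ γ' : ℂ} (hq : ∀ n : ℤ, q ≠ n) (W : ℕ → ℂ)
    (hk : k ≤ 0 → γ = 0 ∧ γ' = 0)
    (h1 : ∀ m : ℕ, (k - 1 - q) * (W (m + 1) + W m) +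
      (2 + m) * (1 - k) * (W (m + 2) + 2 * W (m + 1) + W m) + γ * Ring.choose q (m + 1) = 0)
    (h2 : ∀ m : ℕ, (k - q) * W (m + 1) + (2 + m) * (1 - k) * (W (m + 2) + W (m + 1)) +
      γ' * Ring.choose (q - 1) (m + 1) = 0) :
    ∃ C : ℂ, (k < 0 → C = 0) ∧ ∀ m, W m = C * Ring.choose (q - 1) m := by
  set b : ℕ → ℂ := fun m => Ring.choose (q - 1) m with hb
  have hb1 (m : ℕ) : (m + 1) * b (m + 1) = (q - 1 - m) * b m := choose_succ_mul (q - 1) m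
  have hb2 (m : ℕ) : Ring.choose q (m + 1) = b m + b (m + 1) := by
    have := Ring.choose_succ_succ (q - 1) m
    rwa [sub_add_cancel] at this
  have hb0 : b 0 = 1 := Ring.choose_zero_right _
  set Z : ℕ → ℂ := fun m => (1 - k) * (m + 1) * (W m + W (m + 1)) - q * W m + γ * b m with hZ
  have hZ1 (m : ℕ) : Z (m + 1) = -Z m := by
    have := h1 m
    rw [hb2] at this
    simp only [hZ]
    push_cast
    linear_combination this
  have hZ2 (m : ℕ) : Z (m + 1) + k * W (m + 1) + (γ' - γ) * b (m + 1) = 0 := by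
    have := h2 m
    simp only [hZ]
    push_cast
    linear_combination this
  rcases eq_or_ne k 0 with rfl | hk0
  · obtain ⟨rfl, rfl⟩ := hk le_rfl
    have hZ0 (m : ℕ) : Z m = 0 := by
      have := hZ2 m
      simp only [Int.cast_zero, zero_mul, sub_zero, add_zero] at this
      rw [hZ1] at this
      linear_combination -this
    refine ⟨W 0, fun h => absurd h (lt_irrefl _), fun m => ?_⟩
    induction m with
    | zero => rw [Ring.choose_zero_right, mul_one]
    | succ m ih =>
      have h := hZ0 m
      have hm : (m + 1 : ℂ) ≠ 0 := by exact_mod_cast m.succ_ne_zero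
      simp only [hZ, Int.cast_zero, zero_mul, add_zero, sub_zero, one_mul, ih] at h
      refine mul_left_cancel₀ hm ?_
      linear_combination h - W 0 * hb1 m
  · have hkC : (k : ℂ) ≠ 0 := by exact_mod_cast hk0
    have hkq : (k - q : ℂ) ≠ 0 := fun h => hq k (by linear_combination -h)
    set δ := γ' - γ
    have hZ3 (m : ℕ) : (k - q) * Z (m + 1) = k * (q * δ + γ) * b (m + 1) := by
      have e1 := hZ2 m
      have e2 := hZ2 (m + 1)
      have e3 := hZ1 (m + 1)
      have e4 := hb1 (m + 1)
      have e5 : Z (m + 1) = (1 - k) * (m + 1 + 1) * (W (m + 1) + W (m + 2)) - q * W (m + 1) +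
        γ * b (m + 1) := by simp [hZ]
      push_cast at e4
      linear_combination k * e5 + (1 - k) * (m + 2) * (e1 + e2 - e3) - q * e1 - (1 - k) * δ * e4
    have hc : q * δ + γ = 0 := by
      have e1 := hZ3 0
      have e2 := hZ3 1
      rw [hZ1 1] at e2
      have hne : Ring.choose q 2 ≠ 0 := choose_ne_zero fun j _ => by exact_mod_cast hq j
      rw [hb2 1] at hne
      refine (mul_eq_zero.1 ((mul_eq_zero.1 (?_ : (k * (q * δ + γ)) * (b 1 + b 2) = 0)).resolve_right
        hne)).resolve_left hkC
      simp only [zero_add] at e1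
      linear_combination -e1 - e2
    have hZ0 : Z 0 = 0 := by
      have e1 := hZ3 0
      rw [hc, mul_zero, zero_mul, hZ1 0, mul_neg, neg_eq_zero] at e1
      exact (mul_eq_zero.1 e1).resolve_left hkq
    have hZ4 (m : ℕ) : Z m = 0 := by
      induction m with
      | zero => exact hZ0
      | succ m ih => rw [hZ1, ih, neg_zero]
    have hW (m : ℕ) : W (m + 1) = -δ / k * b (m + 1) := by
      have := hZ2 m
      rw [hZ4] at this
      field_simp
      linear_combination this
    refine ⟨-δ / k, fun h => ?_, fun m => ?_⟩
    · obtain ⟨h1, h2⟩ := hk h.le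
      simp [δ, h1, h2]
    · cases m with
      | succ m => exact hW m
      | zero =>
        have e := hZ0
        have e1 := hb1 0
        simp only [hZ, hb0, hW 0, zero_add, Nat.cast_zero] at e e1
        have hne : (1 - k - q : ℂ) ≠ 0 := fun h => hq (1 - k) (by push_cast; linear_combination -h)
        rw [Ring.choose_zero_right, mul_one, eq_div_iff hkC]
        refine mul_left_cancel₀ hne ?_
        field_simp at e
        linear_combination e - (1 - k) * (-δ) * e1 - k * hc

end FixedLanding

section Mix

variable {V : VOA} {g : VOAAut V} {T l i : ℕ} {φ : V.carrier →ₗ[ℂ] ℂ}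

theorem Kills.crit_gen (hφ : Kills V g T l i φ) {r : ℕ} (hr : Crit T l i r) {k : ℤ}
    {u : V.carrier} (hu : u ∈ V.wtSpace k) (hur : u ∈ eigSpace V g T r) (v : V.carrier) :
    pr φ u v (E (k - 1 + r / T) 0) = 0 := by
  have := hφ.gen hr.lt hu hur v
  rwa [hr.cexp_eq, hr.pexp_eq] at this

theorem Kills.crit_gen_skew (hφ : Kills V g T l i φ) {r : ℕ} (hr : Crit T l i r) {k : ℤ}
    {u v : V.carrier} (hu : u ∈ V.wtSpace k) (hv : v ∈ eigSpace V g T (T - r)) :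
    pr φ u v (E (k - 2 + r / T) 0) = 0 := by
  have hT : (T : ℂ) ≠ 0 := by exact_mod_cast (hr.pos.trans hr.lt).ne'
  refine map_eq_zero_of_eigSpace (T - r) (φ ∘ₗ V.rs (E (k - 2 + r / T) 0) u)
    (fun k' v hv hvt => ?_) hv
  have h := hφ.crit_gen hr.symm hv hvt u
  rw [hφ.skew hu hv, zpow_zero, neg_one_mul, neg_eq_zero] at h
  rw [LinearMap.comp_apply, ← pr_apply, ← h, Nat.cast_sub hr.lt.le]
  congr 2
  push_cast
  field_simp
  ring

theorem Kills.mix_sum (hφ : Kills V g T l i φ) (hT : 0 < T) (hl : l = 0) {q : ℂ} {k : ℤ}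
    {u v : V.carrier} (hu : u ∈ V.wtSpace k) (ε : ℕ) (hε : ε ≤ 1)
    (hz : ∀ n : ℤ, pr φ u (V.rs (E 2 n) V.conformal v) (E (k - 2 + q + ε) 0) = 0) {J : ℕ}
    (hJ : ∀ j : ℕ, J + 2 ≤ j → V.mode V.conformal j u = 0) {C : ℕ → ℂ}
    (hC : ∀ j m : ℕ, pr φ (V.mode V.conformal (j + 2 : ℕ) u) v
      (E (k - (j + 2 : ℕ) + q) (-(m + 1 : ℤ))) = C j * Ring.choose (q - 1) m) (ι : ℕ) :
    pr φ (V.mode V.conformal 0 u) v (E (k + q + ε) (-(2 + ι : ℤ))) -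
      (2 + ι) * k * pr φ u v (E (k + q + ε) (-(3 + ι : ℤ))) +
      2 * k * pr φ u v (E (k - 1 + q + ε) (-(2 + ι : ℤ))) +
      (∑ j ∈ Finset.range J, C j * ∑ e ∈ Finset.range (j + 2 + 1), Ring.choose (2 : ℂ) e *
        ((-1) ^ (j + 2 - e) * Ring.choose (q - 1 + ε + (j + 2 - e : ℕ)) (j + 2 - e))) *
        Ring.choose (q - 1 + ε) (ι + 1) = 0 := by
  have h := comm_E φ V.conformal u hJ 2 (k - 2 + q + ε) (-(2 + ι : ℤ)) 0 v
  have h1 := hφ.fixed_pole hT hl V.conformal_wt conformal_mem_eigSpace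
    (V.rs (E (k - 2 + q + ε) 0) u v) 0 ι (by lia)
  have h2 := hz (-(2 + ι : ℤ))
  rw [pr_apply] at h1 h2
  rw [Nat.cast_zero, add_zero, Int.cast_ofNat] at h1
  rw [h1, h2, sub_zero, Finset.sum_range_succ', Finset.sum_range_succ'] at h
  have hk (x : ℂ) (n : ℤ) : pr φ (V.mode V.conformal (0 + 1 : ℕ) u) v (E x n) =
      k * pr φ u v (E x n) := by
    rw [zero_add, Nat.cast_one, V.L0_grading k u hu]
    simp [pr_apply]
  rw [Finset.sum_range_one, Finset.sum_range_succ _ 1, Finset.sum_range_one, hk, hk] at h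
  have hs : ∑ j ∈ Finset.range J, ∑ e ∈ Finset.range (j + 1 + 1 + 1),
      Ring.choose (2 : ℂ) e * Ring.choose ((-(2 + ι : ℤ) : ℤ) : ℂ) (j + 1 + 1 - e) *
      pr φ (V.mode V.conformal (j + 1 + 1 : ℕ) u) v
        (E (2 - e + (k - 2 + q + ε)) (-(2 + ι : ℤ) - (j + 1 + 1 - e : ℕ) + 0)) =
      (∑ j ∈ Finset.range J, C j * ∑ e ∈ Finset.range (j + 2 + 1), Ring.choose (2 : ℂ) e *
        ((-1) ^ (j + 2 - e) * Ring.choose (q - 1 + ε + (j + 2 - e : ℕ)) (j + 2 - e))) *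
        Ring.choose (q - 1 + ε) (ι + 1) := by
    rw [Finset.sum_mul]
    refine Finset.sum_congr rfl fun j _ => ?_
    rw [mul_assoc, Finset.sum_mul, Finset.mul_sum]
    refine Finset.sum_congr rfl fun e he => ?_
    obtain ⟨d, hd⟩ : ∃ d, j + 2 = e + d := ⟨j + 2 - e, by have := Finset.mem_range.1 he; lia⟩
    have e1 := pr_mix (hC j) (d + ε) (1 - ε + ι)
    have e2 := choose_mul_choose_shift (q - 1 + ε) (ι + 1) d
    have hdc : (j + 2 : ℂ) = e + d := by exact_mod_cast hd
    rw [show j + 1 + 1 = j + 2 by rfl, show j + 2 - e = d by lia,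
      show (2 - e + (k - 2 + q + ε) : ℂ) = k - (j + 2 : ℕ) + q + (d + ε : ℕ) by
        push_cast; linear_combination hdc,
      show (-(2 + ι : ℤ) - d + 0) = -((d + ε : ℕ) + 1 + (1 - ε + ι : ℕ)) by lia, e1,
      show d + ε + (1 - ε + ι) = ι + 1 + d by lia,
      show (q - 1 + (d + ε : ℕ) : ℂ) = q - 1 + ε + d by push_cast; ring,
      show ((-(2 + ι : ℤ) : ℤ) : ℂ) = -1 - (ι + 1 : ℕ) by push_cast; ring]
    linear_combination Ring.choose (2 : ℂ) e * C j * e2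
  rw [hs] at h
  refine Eq.trans ?_ h.symm
  simp only [zero_add, Nat.cast_zero, Nat.cast_one, Nat.sub_zero, Nat.sub_self, sub_zero, one_mul,
    Ring.choose_zero_right, Ring.choose_one_right, mul_one, add_zero]
  rw [show (2 + (k - 2 + q + ε) : ℂ) = k + q + ε by ring,
    show (2 - 1 + (k - 2 + q + ε) : ℂ) = k - 1 + q + ε by ring,
    show -(2 + ι : ℤ) - 1 = -(3 + ι) by ring]
  push_cast
  ring

theorem Kills.mix (hφ : Kills V g T l i φ) {r : ℕ} (hr : Crit T l i r) (k : ℤ) :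
    ∀ u ∈ V.wtSpace k, u ∈ eigSpace V g T r → ∀ v ∈ eigSpace V g T (T - r),
      ∃ C : ℂ, (k < 0 → C = 0) ∧ ∀ m : ℕ, pr φ u v (E (k - 1 + r / T) (-(m + 1 : ℤ))) =
        C * Ring.choose (r / T - 1 : ℂ) m := by
  refine wt_induction V (P := fun k => ∀ u ∈ V.wtSpace k, u ∈ eigSpace V g T r →
    ∀ v ∈ eigSpace V g T (T - r), ∃ C : ℂ, (k < 0 → C = 0) ∧ ∀ m : ℕ,
      pr φ u v (E (k - 1 + r / T) (-(m + 1 : ℤ))) = C * Ring.choose (r / T - 1 : ℂ) m)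
    (fun k hk u hu _ v _ => ?_) (fun k ih u hu hur v hv => ?_) k
  · rw [hk, Submodule.mem_bot] at hu
    refine ⟨0, fun _ => rfl, fun m => ?_⟩
    rw [pr_apply, hu]
    simp
  have hT := hr.pos.trans hr.lt
  set q : ℂ := r / T with hq
  obtain ⟨J, hJ⟩ := exists_mode_eq_zero V V.conformal u 0
  have hex (j : ℕ) : ∃ C : ℂ, (k ≤ 0 → C = 0) ∧ ∀ m : ℕ,
      pr φ (V.mode V.conformal (j + 2 : ℕ) u) v (E (k - (j + 2 : ℕ) + q) (-(m + 1 : ℤ))) =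
        C * Ring.choose (q - 1) m := by
    obtain ⟨C, hC, hC'⟩ := ih (k + 1 - (j + 2 : ℕ)) (by lia) (V.mode V.conformal (j + 2 : ℕ) u) (by
      have := V.mode_grading 2 k (j + 2 : ℕ) _ u V.conformal_wt hu
      rwa [show 2 + k - ((j + 2 : ℕ) : ℤ) - 1 = k + 1 - (j + 2 : ℕ) by ring] at this)
      (mode_mem_eigSpace_left conformal_mem_eigSpace hur _) v hv
    refine ⟨C, fun h => hC (by lia), fun m => ?_⟩
    rw [← hC' m]
    congr 2
    push_cast
    ring
  choose C hC0 hC using hex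
  have hJ' (j : ℕ) (hj : J + 2 ≤ j) : V.mode V.conformal j u = 0 := by simpa using hJ j (by lia)
  have hv' (n : ℤ) : V.rs (E 2 n) V.conformal v ∈ eigSpace V g T (T - r) :=
    rs_mem _ fun n => mode_mem_eigSpace_left conformal_mem_eigSpace hv n
  have h1 := hφ.mix_sum hT hr.l_eq (q := q) hu 1 le_rfl (fun n => by
    rw [← hφ.crit_gen hr hu hur (V.rs (E 2 n) V.conformal v)]
    congr 2
    push_cast
    ring) hJ' hC
  have h0 := hφ.mix_sum hT hr.l_eq (q := q) hu 0 zero_le_one (fun n => by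
    rw [Nat.cast_zero, add_zero, hφ.crit_gen_skew hr hu (hv' n)]) hJ' hC
  obtain ⟨γ, hγ⟩ : ∃ γ : ℕ → ℂ, ∀ ε, γ ε = ∑ j ∈ Finset.range J, C j * ∑ e ∈ Finset.range (j + 2 + 1),
    Ring.choose (2 : ℂ) e *
      ((-1) ^ (j + 2 - e) * Ring.choose (q - 1 + ε + (j + 2 - e : ℕ)) (j + 2 - e)) :=
    ⟨_, fun _ => rfl⟩
  refine mix_recursion (q := q) (γ := γ 1) (γ' := γ 0) (div_ne_intCast hr.pos hr.lt)
    (fun m => pr φ u v (E (k - 1 + q) (-(m + 1 : ℤ)))) (fun hk => ⟨?_, ?_⟩) (fun m => ?_)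
    (fun m => ?_)
  · exact (hγ _).trans <| Finset.sum_eq_zero fun j _ => by rw [hC0 j hk, zero_mul]
  · exact (hγ _).trans <| Finset.sum_eq_zero fun j _ => by rw [hC0 j hk, zero_mul]
  · have h := h1 m
    rw [← hγ] at h
    have a1 := pr_succ φ u v (k - 1 + q) (-(2 + m : ℤ))
    have a2 := pr_succ φ u v (k - 1 + q) (-(3 + m : ℤ))
    have a3 := pr_succ φ u v (k + q) (-(3 + m : ℤ))
    rw [show (k - 1 + q + 1 : ℂ) = k + q by ring] at a1 a2
    rw [show -(2 + m : ℤ) + 1 = -(m + 1) by ring] at a1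
    rw [show -(3 + m : ℤ) + 1 = -(2 + m) by ring] at a2 a3
    rw [pr_L, Nat.cast_one, show -(2 + m : ℤ) - 1 = -(3 + m) by ring,
      show (k - 1 + q + 1 : ℂ) = k + q by ring, show (q - 1 + 1 : ℂ) = q by ring,
      add_sub_cancel_right, a3, a2, a1] at h
    rw [show -((m + 1 : ℕ) + 1 : ℤ) = -(2 + m) by push_cast; ring,
      show -((m + 2 : ℕ) + 1 : ℤ) = -(3 + m) by push_cast; ring]
    push_cast at h ⊢
    linear_combination h
  · have h := h0 m
    rw [← hγ] at h
    have a2 := pr_succ φ u v (k - 1 + q) (-(3 + m : ℤ))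
    rw [show (k - 1 + q + 1 : ℂ) = k + q by ring] at a2
    rw [show -(3 + m : ℤ) + 1 = -(2 + m) by ring] at a2
    rw [pr_L, Nat.cast_zero, add_zero, add_zero, show -(2 + m : ℤ) - 1 = -(3 + m) by ring,
      add_zero, show (k + q - 1 : ℂ) = k - 1 + q by ring, a2] at h
    rw [show -((m + 1 : ℕ) + 1 : ℤ) = -(2 + m) by push_cast; ring,
      show -((m + 2 : ℕ) + 1 : ℤ) = -(3 + m) by push_cast; ring]
    push_cast at h ⊢
    linear_combination h

end Mix

section LeftIdeal

variable {V : VOA} {g : VOAAut V} {T l i : ℕ} {φ : V.carrier →ₗ[ℂ] ℂ}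

theorem eq_zero_of_sum_triangular {J : ℕ} {C : ℕ → ℂ} {c : ℕ → ℕ → ℂ}
    (hc : ∀ d < J, c d d ≠ 0)
    (h : ∀ d < J, ∑ j ∈ Finset.range J, (if d ≤ j then C j * c d j else 0) = 0) :
    ∀ j < J, C j = 0 := by
  suffices H : ∀ n j, j < J → J ≤ j + n → C j = 0 from fun j hj => H J j hj (by lia)
  intro n
  induction n with
  | zero => intro j h1 h2; lia
  | succ n ih =>
    intro d hd _
    have h1 := h d hd
    rw [Finset.sum_eq_single_of_mem d (Finset.mem_range.2 hd), if_pos le_rfl] at h1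
    · exact (mul_eq_zero.1 h1).resolve_right (hc d hd)
    · intro j hj hjd
      split_ifs with hdj
      · rw [ih j (Finset.mem_range.1 hj) (by lia), zero_mul]
      · rfl

theorem Kills.crit_mode_pole_fixed (hφ : Kills V g T l i φ) {r : ℕ} (hr : Crit T l i r) {w k : ℤ}
    {b u v : V.carrier} (hb : b ∈ V.wtSpace w) (hb' : b ∈ eigSpace V g T 0)
    (hu : u ∈ V.wtSpace k) (hur : u ∈ eigSpace V g T r) (hv : v ∈ eigSpace V g T (T - r))
    (j m : ℕ) :
    pr φ (V.mode b j u) v (E (w + k - j - 1 - 1 + r / T) (-(m : ℤ))) = 0 := by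
  set q : ℂ := r / T with hq
  have hwt (j : ℕ) : V.mode b j u ∈ V.wtSpace (w + k - j - 1) := V.mode_grading w k j b u hb hu
  have heig (j : ℕ) : V.mode b j u ∈ eigSpace V g T r := mode_mem_eigSpace_left hb' hur j
  have hex (j : ℕ) : ∃ C : ℂ, ∀ m : ℕ, pr φ (V.mode b j u) v
      (E (w + k - j - 1 - 1 + q) (-(m + 1 : ℤ))) = C * Ring.choose (q - 1) m := by
    obtain ⟨C, -, hC⟩ := hφ.mix hr _ _ (hwt j) (heig j) v hv
    exact ⟨C, fun m => by rw [← hC m]; push_cast; rfl⟩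
  choose C hC using hex
  obtain ⟨C', -, hC'⟩ := hφ.mix hr k u hu hur (V.rs (E w (-2)) b v)
    (rs_mem _ fun n => mode_mem_eigSpace_left hb' hv n)
  obtain ⟨J, hJ⟩ := exists_mode_eq_zero V b u 0
  have hJ' (j : ℕ) (hj : J ≤ j) : V.mode b j u = 0 := by simpa using hJ j hj
  have hc : ∀ d < J, ∑ j ∈ Finset.range J, (if d ≤ j then
      C j * (Ring.choose (w : ℂ) (j - d) * Ring.choose (-2 : ℂ) d) else 0) = 0 := by
    refine coeff_eq_zero_of_sum_choose (q := q) (div_ne_intCast hr.pos hr.lt) J _ C' fun m => ?_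
    have h := comm_E φ b u hJ' w (k - 1 + q) (-2) (-(m + 1 : ℤ)) v
    have h1 := hφ.fixed_pole (hr.pos.trans hr.lt) hr.l_eq hb hb'
      (V.rs (E (k - 1 + q) (-(m + 1 : ℤ))) u v) 0 0 le_rfl
    have h2 := hC' m
    rw [pr_apply] at h1 h2
    rw [Nat.cast_zero, add_zero, Nat.cast_zero, add_zero] at h1
    rw [h1, h2, zero_sub, neg_eq_iff_add_eq_zero, add_comm] at h
    refine Eq.trans ?_ h
    congr 1
    simp_rw [Finset.sum_mul]
    rw [Finset.sum_comm]
    refine Finset.sum_congr rfl fun j hj => ?_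
    have hj := Finset.mem_range.1 hj
    rw [← Finset.sum_flip (n := j), ← Finset.sum_subset (Finset.range_subset_range.2 hj)]
    · refine Finset.sum_congr rfl fun d hd => ?_
      have hd : d ≤ j := Nat.lt_succ_iff.1 (Finset.mem_range.1 hd)
      obtain ⟨e, rfl⟩ := Nat.exists_eq_add_of_le hd
      have h3 := pr_mix (hC (d + e)) (d + 1) (m + 1)
      rw [if_pos hd, show d + e - (d + e - d) = d by lia, show d + e - d = e by lia,
        show (w - e + (k - 1 + q) : ℂ) = w + k - (d + e : ℕ) - 1 - 1 + q + (d + 1 : ℕ) by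
          push_cast; ring,
        show -2 - (d : ℤ) + -(m + 1) = -((d + 1 : ℕ) + 1 + (m + 1 : ℕ)) by push_cast; ring, h3,
        show d + 1 + (m + 1) = m + 2 + d by ring,
        show (q - 1 + (d + 1 : ℕ) : ℂ) = q + d by push_cast; ring]
      push_cast
      ring
    · intro d _ hd
      rw [if_neg fun h => hd (Finset.mem_range.2 (Nat.lt_succ_iff.2 h)), zero_mul]
  have hz := eq_zero_of_sum_triangular (c := fun d j =>
    Ring.choose (w : ℂ) (j - d) * Ring.choose (-2 : ℂ) d) (fun d _ => ?_) hc
  · rcases lt_or_ge j J with hj | hj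
    · cases m with
      | zero =>
        rw [← hφ.crit_gen hr (hwt j) (heig j) v]
        push_cast
        rfl
      | succ m =>
        have := hC j m
        rw [hz j hj, zero_mul] at this
        exact_mod_cast this
    · rw [hJ' j hj, pr_apply]
      simp
  · rw [Nat.sub_self, Ring.choose_zero_right, one_mul]
    exact choose_ne_zero fun j _ h => by
      have : ((-2 : ℤ) : ℂ) = (j : ℤ) := by exact_mod_cast h
      have := Int.cast_injective this
      lia

theorem Kills.star_crit_of (hφ : Kills V g T l i φ) {r : ℕ} (hr : Crit T l i r) {w k : ℤ}
    {a u v : V.carrier} (hu : u ∈ V.wtSpace k) (hur : u ∈ eigSpace V g T r)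
    (h : ∀ j d : ℕ, pr φ (V.mode a j u) v
      (E (w + k - j - 1 - 1 + r / T + d) (-(d : ℤ))) = 0) :
    pr φ a (V.rs (E (k - 1 + r / T) 0) u v) (E w (-1)) = 0 := by
  obtain ⟨J, hJ⟩ := exists_mode_eq_zero V a u 0
  have h1 := comm_E φ a u (fun j hj => by simpa using hJ j hj) w (k - 1 + r / T) (-1) 0 v
  have h2 := hφ.crit_gen hr hu hur (V.rs (E w (-1)) a v)
  rw [pr_apply] at h2 ⊢
  rw [h2, sub_zero] at h1
  rw [h1]
  refine Finset.sum_eq_zero fun j _ => Finset.sum_eq_zero fun e he => ?_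
  obtain ⟨d, rfl⟩ := Nat.exists_eq_add_of_le (Nat.lt_succ_iff.1 (Finset.mem_range.1 he))
  have h3 := h (e + d) (d + 1)
  rw [show e + d - e = d by lia,
    show (w - e + (k - 1 + r / T) : ℂ) = w + k - (e + d : ℕ) - 1 - 1 + r / T + (d + 1 : ℕ) by
      push_cast; ring,
    show -1 - (d : ℤ) + 0 = -(d + 1 : ℕ) by push_cast; ring, h3, mul_zero]

theorem pexp_pos_or_crit {r : ℕ} (hr : r < T) : 0 < pexp T l i r ∨ Crit T l i r := by
  rcases Nat.eq_zero_or_pos (pexp T l i r) with h | h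
  · rcases Nat.eq_zero_or_pos r with rfl | h0
    · rw [pexp_zero] at h
      lia
    · exact Or.inr ⟨h0, hr, h⟩
  · exact Or.inl h

theorem Kills.star_gen_crit (hφ : Kills V g T l i φ) {r t : ℕ} (hr : Crit T l i r) (ht : t < T)
    {w k : ℤ} {a u v : V.carrier} (ha : a ∈ V.wtSpace w) (ha' : a ∈ eigSpace V g T 0)
    (hu : u ∈ V.wtSpace k) (hur : u ∈ eigSpace V g T r) (hv : v ∈ eigSpace V g T t) :
    pr φ a (V.rs (E (k - 1 + r / T) 0) u v) (E w (-1)) = 0 := by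
  have hT := hr.pos.trans hr.lt
  have hlt := Nat.mod_lt (r + t) hT
  rcases Nat.eq_zero_or_pos ((r + t) % T) with h0 | h0
  · obtain rfl : t = T - r := by
      obtain ⟨c, hc⟩ := Nat.dvd_of_mod_eq_zero h0
      have := hr.pos
      have := hr.lt
      have h1 : c < 2 := by
        by_contra! h2
        have := Nat.mul_le_mul_left T h2
        lia
      interval_cases c <;> lia
    refine hφ.star_crit_of hr hu hur fun j d => ?_
    have := pr_mix_zero (fun m => hφ.crit_mode_pole_fixed hr ha ha' hu hur hv j m) d 0
    simpa using this
  · rcases pexp_pos_or_crit (l := l) (i := i) hlt with h | h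
    · refine hφ.eq_zero_of_pexp_pos h0 hlt h (rs_mem _ fun n => mode_mem_eigSpace_left ha' ?_ n)
      rw [eigSpace_mod hT]
      exact rs_mem _ fun n => mode_mem_eigSpace hur hv n
    · refine hφ.star_crit_of hr hu hur fun j d => ?_
      obtain ⟨N, hN⟩ := exists_mode_eq_zero V (V.mode a j u) v (-(d : ℤ))
      rw [pr_E φ _ _ _ _ hN]
      refine Finset.sum_eq_zero fun n _ => ?_
      rw [hφ.crit_mode_mode h hr rfl ha ha' hu hur hv, mul_zero]

end LeftIdeal

section LeftMul

variable {V : VOA} {g : VOAAut V} {T l i : ℕ} {φ : V.carrier →ₗ[ℂ] ℂ}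

theorem Kills.left_gen (hφ : Kills V g T l i φ) (hT : 0 < T) (hg : g.lin ^ T = 1) {r : ℕ}
    (hr : r < T) {w k : ℤ} {a u : V.carrier} (ha : a ∈ V.wtSpace w) (ha' : a ∈ eigSpace V g T 0)
    (hu : u ∈ V.wtSpace k) (hur : u ∈ eigSpace V g T r) (v : V.carrier) :
    pr φ a (V.rs (E (k - 1 + cexp T l i r) (-(pexp T l i r : ℤ))) u v) (starSer l w) = 0 := by
  rcases pexp_pos_or_crit (l := l) (i := i) hr with hp | hc
  · exact hφ.star_gen hr hp ha ha' hu hur v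
  · rw [hc.cexp_eq, hc.pexp_eq, pr_starSer, hc.l_eq]
    have := map_eq_zero_of_homogeneous hT hg
      (φ ∘ₗ V.rs (E w (-1)) a ∘ₗ V.rs (E (k - 1 + r / T) 0) u)
      (fun t ht _ v _ hv => hφ.star_gen_crit hc ht ha ha' hu hur hv) v
    simpa [pr_apply] using this

theorem Kills.left_mul (hφ : Kills V g T l i φ) (hT : 0 < T) (hg : g.lin ^ T = 1)
    {x : V.carrier} (hx : x ∈ Ogn V g T l i) (a : V.carrier) : φ (starMul V g T l a x) = 0 := by
  refine map_eq_zero_of_homogeneous hT hg (φ ∘ₗ (starMulL V g T l).flip x)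
    (fun r hr w a ha har => ?_) a
  rw [LinearMap.comp_apply, LinearMap.flip_apply, starMulL_apply, starMul_of_mem hT hr ha har]
  split_ifs with h0
  · subst h0
    induction hx using Submodule.span_induction with
    | mem x hx =>
      rcases hx with ⟨u, rfl⟩ | ⟨r, hr, k, u, v, hu, hur, rfl⟩
      · exact hφ.star_L hT ha har u
      · rw [Ogn_gen_eq]
        exact hφ.left_gen hT hg hr ha har hu hur v
    | zero => rw [map_zero, map_zero]
    | add x y _ _ hx hy => rw [map_add, map_add, hx, hy, add_zero]
    | smul c x _ hx => rw [map_smul, map_smul, hx, smul_zero]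
  · exact map_zero φ

end LeftMul

section RightMul

variable {V : VOA} {g : VOAAut V} {T l i : ℕ} {φ : V.carrier →ₗ[ℂ] ℂ}

theorem sum_choose_mul_add {F : ℕ → ℤ → ℂ} (hF : ∀ j n, F (j + 1) n = F j n + F j (n + 1))
    (n k : ℕ) :
    ∑ m ∈ Finset.range (k + 1), ((m + (n + 1)).choose (n + 1) : ℂ) * F m (-(n + m + 2 : ℤ)) +
      ∑ m ∈ Finset.range (k + 1), ((m + n).choose n : ℂ) * F m (-(n + m + 1 : ℤ)) =
      ((k + n + 1).choose (n + 1) : ℂ) * F (k + 1) (-(k + n + 2 : ℤ)) := by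
  induction k with
  | zero =>
    have := hF 0 (-(n + 2 : ℤ))
    rw [show -(n + 2 : ℤ) + 1 = -(n + 1) by ring] at this
    simp only [zero_add, Finset.sum_range_one, Nat.cast_zero, add_zero, Nat.choose_self,
      Nat.cast_one, one_mul] at this ⊢
    rw [this]
  | succ k ih =>
    rw [Finset.sum_range_succ, Finset.sum_range_succ _ (k + 1), add_add_add_comm, ih]
    have h := hF (k + 1) (-(n + k + 3 : ℤ))
    rw [show -(n + k + 3 : ℤ) + 1 = -(k + n + 2) by ring] at h
    have hc : ((k + 1 + n + 1).choose (n + 1) : ℂ) =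
        (k + 1 + n).choose n + (k + n + 1).choose (n + 1) := by
      rw [Nat.choose_succ_succ, show k + 1 + n = k + n + 1 by ring]
      push_cast
      ring
    rw [show -((k + 1 : ℕ) + n + 2 : ℤ) = -(n + k + 3) by push_cast; ring,
      show -(n + (k + 1 : ℕ) + 2 : ℤ) = -(n + k + 3) by push_cast; ring,
      show -(n + (k + 1 : ℕ) + 1 : ℤ) = -(k + n + 2) by push_cast; ring,
      show k + 1 + (n + 1) = k + 1 + n + 1 by ring, h, hc]
    ring

/-- The Chaundy–Bullard identity. -/
theorem chaundy_bullard {F : ℕ → ℤ → ℂ} (hF : ∀ j n, F (j + 1) n = F j n + F j (n + 1))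
    (k n : ℕ) :
    ∑ m ∈ Finset.range (n + 1),
        (-1) ^ m * ((m + k).choose k : ℂ) * F (k + 1) (-(k + m + 1 : ℤ)) -
      (-1) ^ n * ∑ m ∈ Finset.range (k + 1), ((m + n).choose n : ℂ) * F m (-(n + m + 1 : ℤ)) =
      F 0 0 := by
  induction n with
  | zero =>
    simp only [zero_add, Finset.sum_range_one, pow_zero, Nat.choose_self, Nat.cast_one, one_mul,
      Nat.cast_zero, add_zero, Nat.choose_zero_right]
    induction k with
    | zero =>
      have := hF 0 (-1)
      rw [neg_add_cancel] at this
      simp [this]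
    | succ k ih =>
      have h := hF (k + 1) (-(k + 2 : ℤ))
      rw [show -(k + 2 : ℤ) + 1 = -(k + 1) by ring] at h
      rw [Finset.sum_range_succ, ← ih,
        show -((k + 1 : ℕ) + 1 : ℤ) = -(k + 2) by push_cast; ring, h]
      ring
  | succ n ih =>
    have h := sum_choose_mul_add hF n k
    rw [Finset.sum_range_succ, ← ih, pow_succ,
      show -((k : ℤ) + (n + 1 : ℕ) + 1) = -(k + n + 2) by push_cast; ring]
    have hc : (n + 1 + k).choose k = (k + n + 1).choose (n + 1) := by
      rw [show k + n + 1 = n + 1 + k by ring, Nat.choose_symm_add]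
    have hs : ∑ m ∈ Finset.range (k + 1), ((m + (n + 1)).choose (n + 1) : ℂ) *
        F m (-((n + 1 : ℕ) + m + 1 : ℤ)) = ∑ m ∈ Finset.range (k + 1),
        ((m + (n + 1)).choose (n + 1) : ℂ) * F m (-(n + m + 2 : ℤ)) :=
      Finset.sum_congr rfl fun m _ => by
        rw [show -((n + 1 : ℕ) + m + 1 : ℤ) = -(n + m + 2) by push_cast; ring]
    rw [hs, hc]
    linear_combination (-1) ^ n * h

theorem Kills.star_skew (hφ : Kills V g T l i φ) {w k : ℤ} {a x : V.carrier}
    (ha : a ∈ V.wtSpace w) (hx : x ∈ V.wtSpace k) :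
    pr φ x a (starSer l k) = pr φ a x (starSer l w) - pr φ a x (E (w - 1) 0) := by
  have h := chaundy_bullard (F := fun j n => pr φ a x (E (w - 1 + j) n)) (fun j n => by
    rw [← pr_succ]
    push_cast
    ring_nf) l l
  rw [Nat.cast_zero, add_zero] at h
  rw [← h, pr_starSer, pr_starSer, Finset.mul_sum]
  have e1 : ∑ m ∈ Finset.range (l + 1), (-1 : ℂ) ^ m * ((m + l).choose l : ℂ) *
      pr φ a x (E (w + l) (-(l + m + 1 : ℤ))) = ∑ m ∈ Finset.range (l + 1), (-1 : ℂ) ^ m *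
      ((m + l).choose l : ℂ) * pr φ a x (E (w - 1 + (l + 1 : ℕ)) (-(l + m + 1 : ℤ))) := by
    rw [show (w - 1 + (l + 1 : ℕ) : ℂ) = w + l by push_cast; ring]
  have e2 : ∑ m ∈ Finset.range (l + 1), (-1 : ℂ) ^ m * ((m + l).choose l : ℂ) *
      pr φ x a (E (k + l) (-(l + m + 1 : ℤ))) = ∑ m ∈ Finset.range (l + 1), (-1 : ℂ) ^ l *
      (((m + l).choose l : ℂ) * pr φ a x (E (w - 1 + m) (-(l + m + 1 : ℤ)))) := by
    refine Finset.sum_congr rfl fun m _ => ?_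
    have hs : -(-1 : ℂ) ^ (-(l + m + 1 : ℤ)) = (-1) ^ l * (-1) ^ m := by
      rw [zpow_neg, ← inv_zpow, inv_neg_one, zpow_add_one₀ (by simp), zpow_add₀ (by simp),
        zpow_natCast, zpow_natCast]
      ring
    have hm : ((-1 : ℂ) ^ m) * (-1) ^ m = 1 := by rw [← mul_pow]; simp
    rw [hφ.skew ha hx, hs,
      show (w + k - 2 - (-(l + m + 1 : ℤ) : ℤ) - (k + l) : ℂ) = w - 1 + m by push_cast; ring]
    linear_combination (-1) ^ l * ((m + l).choose l : ℂ) *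
      pr φ a x (E (w - 1 + m) (-(l + m + 1 : ℤ))) * hm
  rw [e1, e2]
  ring

theorem Kills.right_gen_fixed (hφ : Kills V g T l i φ) (hT : 0 < T) (hg : g.lin ^ T = 1) {r : ℕ}
    (hr : r < T) {w k : ℤ} {a u v : V.carrier} (ha : a ∈ V.wtSpace w)
    (ha' : a ∈ eigSpace V g T 0) (hu : u ∈ V.wtSpace k) (hur : u ∈ eigSpace V g T r)
    (hx : V.rs (E (k - 1 + cexp T l i r) (-(pexp T l i r : ℤ))) u v ∈ eigSpace V g T 0) :
    φ (starMul V g T l (V.rs (E (k - 1 + cexp T l i r) (-(pexp T l i r : ℤ))) u v) a) = 0 := by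
  have h := map_eq_zero_of_eigSpace 0 (φ ∘ₗ (starMulL V g T l).flip a -
    (φ ∘ₗ starMulL V g T l a - φ ∘ₗ V.rs (E (w - 1) 0) a)) (fun k x hx hx' => by
      have := hφ.star_skew ha hx
      rw [pr_apply, pr_apply, pr_apply] at this
      simp only [LinearMap.sub_apply, LinearMap.comp_apply, LinearMap.flip_apply, starMulL_apply]
      rw [starMul_of_mem hT hT ha ha', starMul_of_mem hT hT hx hx', if_pos rfl, if_pos rfl, this,
        sub_self]) hx
  simp only [LinearMap.sub_apply, LinearMap.comp_apply, LinearMap.flip_apply,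
    starMulL_apply] at h
  rw [sub_eq_zero] at h
  obtain ⟨J, hJ⟩ := exists_mode_eq_zero V a u 0
  have hc := comm_E_zero φ a u (fun j hj => by simpa using hJ j hj) (w - 1)
    (k - 1 + cexp T l i r) (-(pexp T l i r : ℤ)) v
  have h1 := hφ.gen hr hu hur (V.rs (E (w - 1) 0) a v)
  have h2 := hφ.left_gen hT hg hr ha ha' hu hur v
  rw [pr_apply] at h1 h2
  rw [h, starMul_of_mem hT hT ha ha', if_pos rfl, h2, zero_sub, neg_eq_zero]
  rw [h1, sub_zero] at hc
  rw [hc]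
  refine Finset.sum_eq_zero fun j _ => ?_
  rw [← mul_zero, ← hφ.gen hr (V.mode_grading w k j a u ha hu) (mode_mem_eigSpace_left ha' hur j) v]
  congr 3
  push_cast
  ring

end RightMul

section RightIdeal

variable {V : VOA} {g : VOAAut V} {T l i : ℕ} {φ : V.carrier →ₗ[ℂ] ℂ}

theorem Kills.crit_mode_of_ne (hφ : Kills V g T l i φ) {r t s : ℕ} (hs : Crit T l i s)
    (hr : r < T) (hrt : (r + t) % T = s) {k : ℤ} {u y : V.carrier} (hu : u ∈ V.wtSpace k)
    (hur : u ∈ eigSpace V g T r) (hy : y ∈ eigSpace V g T t) {n : ℤ}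
    (hn : n ≠ -1 ∨ k ≠ 0 ∨ (0 < r ∧ 0 < pexp T l i r)) : φ (V.mode u n y) = 0 := by
  rcases Nat.eq_zero_or_pos r with rfl | h0
  · refine hφ.crit_mode_fixed hs hu hur ?_ (hn.imp_right fun h => h.resolve_right (by simp))
    rwa [← hrt, zero_add, eigSpace_mod (hs.pos.trans hs.lt)]
  · rcases pexp_pos_or_crit (l := l) (i := i) hr with hp | hc
    · exact hφ.crit_mode_pole hs h0 hr hp hrt hu hur hy n
    · refine hφ.crit_mode hs hc hrt hu hur hy (hn.imp_right fun h => h.resolve_right ?_)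
      rw [hc.pexp_eq]
      simp

theorem map_mode_mode_neg_one {a u v : V.carrier} {A : Prop}
    (h1 : ∀ p q, p ≠ -1 ∨ A → φ (V.mode u p (V.mode v q a)) = 0)
    (h2 : ∀ p q, q ≠ -1 → φ (V.mode v q (V.mode u p a)) = 0) {P : ℤ} (hP : P ≠ -1 ∨ A) :
    φ (V.mode (V.mode u P v) (-1) a) = 0 := by
  rcases lt_or_ge P 0 with h | h
  · obtain ⟨J₁, hJ₁⟩ := exists_mode_eq_zero V u a 0
    obtain ⟨J₂, hJ₂⟩ := exists_mode_eq_zero V v a (-1)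
    rw [mode_iterate V u v a P (-1) (J := J₁ + J₂) (fun j hj => by simpa using hJ₁ j (by lia))
      (fun j hj => hJ₂ j (by lia)), map_sum]
    refine Finset.sum_eq_zero fun j _ => ?_
    rw [map_smul, map_sub, map_smul, h1 _ _ (by
      rcases hP with hP | hP
      · exact Or.inl (by lia)
      · exact Or.inr hP), h2 _ _ (by lia), smul_zero, sub_zero, smul_zero]
  · obtain ⟨P, rfl⟩ := Int.eq_ofNat_of_zero_le h
    obtain ⟨J, hJ⟩ := exists_mode_eq_zero V u v 0
    have key := sum_choose_consecutive (J + P + 1) ((-2 - (J + P + 1 : ℕ) : ℤ) : ℂ)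
      (fun j => φ (V.mode (V.mode u j v) (P - 1 - j) a)) (fun d hd => ?_) P (by lia)
    · simpa using key
    · set p : ℤ := -2 - (J + P + 1 : ℕ) + d with hpd
      have h := congrArg φ (mode_comm V u v a (J := J + P + 1)
        (fun j hj => by simpa using hJ j (by lia)) p (P - 1 - p))
      rw [map_sub, h1 _ _ (Or.inl (by lia)), h2 _ _ (by lia), sub_zero, map_sum] at h
      rw [h]
      refine Finset.sum_congr rfl fun j _ => ?_
      rw [map_smul, smul_eq_mul, hpd]
      push_cast
      ring_nf

theorem Kills.star_eq_mode (hφ : Kills V g T l i φ) {s : ℕ} (hs : Crit T l i s) {x a : V.carrier}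
    (hx : x ∈ eigSpace V g T 0) (ha : a ∈ eigSpace V g T s) :
    φ (starMul V g T l x a) = φ (V.mode x (-1) a) := by
  have hT := hs.pos.trans hs.lt
  have h := map_eq_zero_of_eigSpace 0 (φ ∘ₗ (starMulL V g T l).flip a -
    φ ∘ₗ LinearMap.applyₗ a ∘ₗ LinearMap.proj (-1) ∘ₗ V.mode) (fun k x hx hx' => by
      simp only [LinearMap.sub_apply, LinearMap.comp_apply, LinearMap.flip_apply, starMulL_apply,
        LinearMap.proj_apply, LinearMap.applyₗ_apply_apply]
      rw [starMul_of_mem hT hT hx hx', if_pos rfl, ← pr_apply, pr_starSer, hs.l_eq]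
      obtain ⟨J, hJ⟩ := exists_mode_eq_zero V x a (-1)
      simp only [zero_add, Finset.sum_range_one, pow_zero, Nat.choose_self, Nat.cast_one, one_mul,
        Nat.cast_zero, add_zero]
      rw [pr_E φ _ _ _ _ (J := J + 1) fun j hj => hJ j (by lia), Finset.sum_range_succ',
        Finset.sum_eq_zero fun j _ => by
          rw [hφ.crit_mode_fixed hs hx hx' ha (Or.inl (by lia)), mul_zero]]
      simp) hx
  simpa [sub_eq_zero, starMulL_apply] using h

theorem Kills.right_gen_crit (hφ : Kills V g T l i φ) {r t s : ℕ} (hs : Crit T l i s)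
    (hr : r < T) (ht : t < T) (hrt : (r + t) % T = 0) {k k' : ℤ} {a u v : V.carrier}
    (ha : a ∈ eigSpace V g T s) (hu : u ∈ V.wtSpace k) (hur : u ∈ eigSpace V g T r)
    (hv : v ∈ V.wtSpace k') (hvt : v ∈ eigSpace V g T t) :
    φ (starMul V g T l (V.rs (E (k - 1 + cexp T l i r) (-(pexp T l i r : ℤ))) u v) a) = 0 := by
  have hT := hs.pos.trans hs.lt
  have huv (n : ℤ) : V.mode u n v ∈ eigSpace V g T 0 := by
    rw [← hrt, eigSpace_mod hT]
    exact mode_mem_eigSpace hur hvt n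
  have hmod : (r + (t + s)) % T = s := by
    rw [← add_assoc, Nat.add_mod, hrt, zero_add, Nat.mod_mod, Nat.mod_eq_of_lt hs.lt]
  rw [hφ.star_eq_mode hs (rs_mem _ huv) ha]
  have hE := pr_E (φ ∘ₗ LinearMap.applyₗ a ∘ₗ LinearMap.proj (-1) ∘ₗ V.mode)
    (k - 1 + cexp T l i r) (-(pexp T l i r : ℤ)) u v (exists_mode_eq_zero V u v _).choose_spec
  rw [pr_apply] at hE
  refine hE.trans (Finset.sum_eq_zero fun n _ => ?_)
  change _ * φ (V.mode (V.mode u _ v) (-1) a) = 0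
  by_cases hw : k + k' - (-(pexp T l i r : ℤ) + n) - 1 = 0
  · by_cases hA : -(pexp T l i r : ℤ) + n ≠ -1 ∨ k ≠ 0 ∨ (0 < r ∧ 0 < pexp T l i r)
    · rw [map_mode_mode_neg_one
        (fun p q h => hφ.crit_mode_of_ne hs hr hmod hu hur (mode_mem_eigSpace hvt ha q) h)
        (fun p q h => hφ.crit_mode_of_ne hs ht (by rwa [add_left_comm]) hv hvt
          (mode_mem_eigSpace hur ha p) (Or.inl h)) hA, mul_zero]
    · push Not at hA
      obtain ⟨hn, rfl, h⟩ := hA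
      have h0 : r = 0 := by
        by_contra h0
        have := h (Nat.pos_of_ne_zero h0)
        lia
      subst h0
      rw [pexp_zero, hs.l_eq] at hn
      obtain rfl : n = 1 := by lia
      rw [cexp_zero, hs.l_eq, Ring.choose_one_right]
      simp
  · rw [hφ.crit_mode_fixed hs (V.mode_grading _ _ _ _ _ hu hv) (huv _) ha (Or.inr hw), mul_zero]

theorem Kills.right_gen (hφ : Kills V g T l i φ) (hT : 0 < T) (hg : g.lin ^ T = 1) {r : ℕ}
    (hr : r < T) {k : ℤ} {u : V.carrier} (hu : u ∈ V.wtSpace k) (hur : u ∈ eigSpace V g T r)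
    (v a : V.carrier) :
    φ (starMul V g T l (V.rs (E (k - 1 + cexp T l i r) (-(pexp T l i r : ℤ))) u v) a) = 0 := by
  refine map_eq_zero_of_homogeneous hT hg (φ ∘ₗ (starMulL V g T l).flip a ∘ₗ
    V.rs (E (k - 1 + cexp T l i r) (-(pexp T l i r : ℤ))) u) (fun t ht k' v hv hvt => ?_) v
  have hx : V.rs (E (k - 1 + cexp T l i r) (-(pexp T l i r : ℤ))) u v ∈
      eigSpace V g T ((r + t) % T) := by
    rw [eigSpace_mod hT]
    exact rs_mem _ fun n => mode_mem_eigSpace hur hvt n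
  simp only [LinearMap.comp_apply, LinearMap.flip_apply, starMulL_apply]
  by_cases h0 : (r + t) % T = 0
  · rw [h0] at hx
    refine map_eq_zero_of_homogeneous hT hg (φ ∘ₗ starMulL V g T l _)
      (fun s hs w a ha has => ?_) a
    rw [LinearMap.comp_apply, starMulL_apply]
    rcases Nat.eq_zero_or_pos s with rfl | hs0
    · exact hφ.right_gen_fixed hT hg hr ha has hu hur hx
    · rcases pexp_pos_or_crit (l := l) (i := i) hs with hp | hc
      · refine map_eq_zero_of_eigSpace 0 (φ ∘ₗ (starMulL V g T l).flip a)
          (fun κ x hx hx' => ?_) hx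
        rw [LinearMap.comp_apply, LinearMap.flip_apply, starMulL_apply,
          starMul_of_mem hT hT hx hx', if_pos rfl]
        exact hφ.eq_zero_of_pexp_pos hs0 hs hp
          (rs_mem _ fun n => mode_mem_eigSpace_left hx' has n)
      · exact hφ.right_gen_crit hc hr ht h0 has hu hur hv hvt
  · refine map_eq_zero_of_eigSpace _ (φ ∘ₗ (starMulL V g T l).flip a) (fun κ x hx hx' => ?_) hx
    rw [LinearMap.comp_apply, LinearMap.flip_apply, starMulL_apply,
      starMul_of_mem hT (Nat.mod_lt _ hT) hx hx', if_neg h0, map_zero]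

theorem Kills.right_mul (hφ : Kills V g T l i φ) (hT : 0 < T) (hg : g.lin ^ T = 1)
    {x : V.carrier} (hx : x ∈ Ogn V g T l i) (a : V.carrier) : φ (starMul V g T l x a) = 0 := by
  rw [← starMulL_apply]
  induction hx using Submodule.span_induction with
  | mem x hx =>
    rcases hx with ⟨y, rfl⟩ | ⟨r, hr, k, u, v, hu, hur, rfl⟩
    · refine map_eq_zero_of_homogeneous hT hg (φ ∘ₗ (starMulL V g T l).flip a ∘ₗ
        (V.mode V.conformal 0 + V.mode V.conformal 1)) (fun r hr k y hy hyr => ?_) y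
      have h0 : V.mode V.conformal 0 y ∈ V.wtSpace (k + 1) := by
        convert V.mode_grading 2 k 0 _ _ V.conformal_wt hy using 1
        ring_nf
      have h0' : V.mode V.conformal 0 y ∈ eigSpace V g T r :=
        mode_mem_eigSpace_left conformal_mem_eigSpace hyr 0
      simp only [LinearMap.comp_apply, LinearMap.add_apply, LinearMap.flip_apply, map_add]
      rw [V.L0_grading k y hy, map_smul, LinearMap.smul_apply, starMulL_apply, starMulL_apply,
        starMul_of_mem hT hr h0 h0', starMul_of_mem hT hr hy hyr]
      split_ifs with h
      · subst h
        have := hφ.star_L_add hT hy hyr a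
        rw [pr_apply, pr_apply] at this
        rw [map_smul, smul_eq_mul, ← this]
        push_cast
        rfl
      · simp
    · rw [Ogn_gen_eq, starMulL_apply]
      exact hφ.right_gen hT hg hr hu hur v a
  | zero => rw [map_zero, LinearMap.zero_apply, map_zero]
  | add x y _ _ hx hy => rw [map_add, LinearMap.add_apply, map_add, hx, hy, add_zero]
  | smul c x _ hx => rw [map_smul, LinearMap.smul_apply, map_smul, hx, smul_zero]

end RightIdeal

end DLM

namespace DLM

/-- **Lemma 2.3 (i).** `O_{g,n}(V)` is a two-sided ideal of `V` under `*_{g,n}`: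
`V *_{g,n} O_{g,n}(V) ⊆ O_{g,n}(V)` and `O_{g,n}(V) *_{g,n} V ⊆ O_{g,n}(V)`. -/
theorem Ogn_two_sided_ideal (V : VOA) (g : VOAAut V) (T : ℕ) (hT : 0 < T)
    (hg : g.lin ^ T = 1) (l i : ℕ) (hi : i ≤ T - 1) :
    ∀ v : V.carrier, ∀ x ∈ Ogn V g T l i,
      starMul V g T l v x ∈ Ogn V g T l i ∧ starMul V g T l x v ∈ Ogn V g T l i := by
  exact fun v x hx => ⟨mem_Ogn_of_kills fun φ hφ => hφ.left_mul hT hg hx v,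
    mem_Ogn_of_kills fun φ hφ => hφ.right_mul hT hg hx v⟩

end DLM
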